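/- Let k be a field, P = k[x_1, …, x_n] a polynomial ring, I ⊆ P an ideal, and ω ∈ (ℤ_{>0})^n a weight vector. Then c(P/in_ω(I)) ≥ c(P/I) − 1. Moreover, if I has more than one minimal prime ideal, the inequality is strict, i.e. c(P/in_ω(I)) ≥ c(P/I). -/

import Mathlib

/-!
Auxiliary definitions: integer-valued topological (Krull) dimension, connectivity
dimension, subdimension, local cohomological dimension and depth.
-/

open TopologicalSpace

/-- The (topological Krull) dimension of a topological space, as an integer:
the supremum of the lengths of strictly increasing chains of irreducible closed subsets,
with the convention that the empty space has dimension `-1`. -/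
noncomputable def topDim (T : Type*) [TopologicalSpace T] : ℤ :=
  sSup ({-1} ∪ {d : ℤ | ∃ n : ℕ, d = (n : ℤ) ∧
    ∃ c : Fin (n + 1) → IrreducibleCloseds T, StrictMono c})

/-- The connectivity dimension `c(T)` of a topological space `T`: the minimum of `topDim Z`
over the closed subsets `Z ⊆ T` such that `T \ Z` is disconnected, the empty space counting
as disconnected (of dimension `-1`). -/
noncomputable def connDim (T : Type*) [TopologicalSpace T] : ℤ :=
  sInf {d : ℤ | ∃ Z : Set T, IsClosed Z ∧ ¬ ConnectedSpace ↥(Zᶜ) ∧ d = topDim ↥Z}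

/-- The subdimension `sdim T` of a topological space: the minimum of the dimensions of its
irreducible components. -/
noncomputable def subDim (T : Type*) [TopologicalSpace T] : ℤ :=
  sInf {d : ℤ | ∃ C ∈ irreducibleComponents T, d = topDim ↥C}

/-- The connectivity dimension `c(R)` of a commutative ring `R`, i.e. that of `Spec R`. -/
noncomputable def ringConnDim (R : Type) [CommRing R] : ℤ :=
  connDim (PrimeSpectrum R)

/-- The cohomological dimension `cd(M, a) = sup { i ∈ ℕ | H^i_a(M) ≠ 0 }` of an ideal `a`
with respect to a module `M`, where `H^i_a` is local cohomology with support in `a`. -/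
noncomputable def cohDim (R : Type) [CommRing R] (a : Ideal R)
    (M : Type) [AddCommGroup M] [Module R M] : ℤ :=
  sSup {d : ℤ | ∃ i : ℕ, d = (i : ℤ) ∧
    Nontrivial ((localCohomology a i).obj (ModuleCat.of R M))}

/-- `depth(a, M)`: the supremum of the lengths of `M`-regular sequences contained in the
ideal `a`. -/
noncomputable def idealDepth (R : Type) [CommRing R] (a : Ideal R)
    (M : Type) [AddCommGroup M] [Module R M] : ℤ :=
  sSup {d : ℤ | ∃ rs : List R, d = (rs.length : ℤ) ∧ (∀ r ∈ rs, r ∈ a) ∧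
    RingTheory.Sequence.IsRegular M rs}

/-- The `ω`-degree of a polynomial: `deg_ω f = max { ω·a | x^a is a term of f }`. -/
noncomputable def wDeg {k : Type} [Field k] {n : ℕ} (ω : Fin n → ℕ)
    (f : MvPolynomial (Fin n) k) : ℕ :=
  f.support.sup fun a => ∑ i, ω i * a i

/-- The initial form `in_ω(f)`: the sum of the terms of `f` of maximal `ω`-degree. -/
noncomputable def initialForm {k : Type} [Field k] {n : ℕ} (ω : Fin n → ℕ)
    (f : MvPolynomial (Fin n) k) : MvPolynomial (Fin n) k :=
  ∑ a ∈ f.support.filter (fun a => ∑ i, ω i * a i = wDeg ω f),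
    MvPolynomial.monomial a (f.coeff a)

/-- The initial ideal `in_ω(I)` of an ideal `I`, generated by the initial forms of its
nonzero elements. -/
noncomputable def initialIdeal {k : Type} [Field k] {n : ℕ} (ω : Fin n → ℕ)
    (I : Ideal (MvPolynomial (Fin n) k)) : Ideal (MvPolynomial (Fin n) k) :=
  Ideal.span {g | ∃ f ∈ I, f ≠ 0 ∧ g = initialForm ω f}

section Wrap1
open MvPolynomial
set_option linter.style.haveILetI false

section FilSec
variable {k : Type} [Field k] {n : ℕ}

/-- polynomials of weighted degree at most `j` -/
def Fil (w : Fin n → ℕ) (j : ℤ) : Submodule k (MvPolynomial (Fin n) k) where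
  carrier := {f | ∀ a, f.coeff a ≠ 0 → ((Finsupp.weight w a : ℕ) : ℤ) ≤ j}
  zero_mem' := by intro a ha; simp at ha
  add_mem' := by
    intro f g hf hg a ha
    by_cases h : f.coeff a = 0
    · apply hg; intro h'; apply ha; simp [h, h']
    · exact hf a h
  smul_mem' := by
    intro c f hf a ha
    apply hf; intro h; apply ha; simp [h]

noncomputable abbrev wc (w : Fin n → ℕ) (j : ℕ) (f : MvPolynomial (Fin n) k) : MvPolynomial (Fin n) k :=
  weightedHomogeneousComponent w j f

variable {w : Fin n → ℕ}

lemma mem_fil {j : ℤ} {f : MvPolynomial (Fin n) k} :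
    f ∈ Fil w j ↔ ∀ a, f.coeff a ≠ 0 → ((Finsupp.weight w a : ℕ) : ℤ) ≤ j := Iff.rfl

lemma fil_mono {i j : ℤ} (h : i ≤ j) {f : MvPolynomial (Fin n) k} (hf : f ∈ Fil w i) :
    f ∈ Fil w j := fun a ha => (hf a ha).trans h

lemma fil_neg {j : ℤ} (h : j < 0) {f : MvPolynomial (Fin n) k} (hf : f ∈ Fil w j) : f = 0 := by
  ext a
  by_contra ha
  have := hf a (by simpa using ha)
  omega

lemma fil_mul {i j : ℤ} {f g : MvPolynomial (Fin n) k} (hf : f ∈ Fil w i) (hg : g ∈ Fil w j) :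
    f * g ∈ Fil w (i + j) := by
  classical
  intro a ha
  rw [coeff_mul] at ha
  obtain ⟨x, hx, hne⟩ := Finset.exists_ne_zero_of_sum_ne_zero ha
  have h1 := hf x.1 (left_ne_zero_of_mul hne)
  have h2 := hg x.2 (right_ne_zero_of_mul hne)
  have : x.1 + x.2 = a := by simpa using hx
  rw [← this, map_add]
  push_cast
  omega

lemma fil_of_hom {j : ℕ} {f : MvPolynomial (Fin n) k} (hf : IsWeightedHomogeneous w f j) :
    f ∈ Fil w j := by
  intro a ha
  rw [hf ha]

lemma fil_one : (1 : MvPolynomial (Fin n) k) ∈ Fil w 0 := by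
  have := fil_of_hom (isWeightedHomogeneous_one k w)
  simpa using this

lemma fil_pow {i : ℤ} {f : MvPolynomial (Fin n) k} (hf : f ∈ Fil w i) (m : ℕ) :
    f ^ m ∈ Fil w (m * i) := by
  induction m with
  | zero => simpa using fil_one
  | succ m ih =>
    rw [pow_succ]
    have e : ((m + 1 : ℕ) : ℤ) * i = m * i + i := by push_cast; ring
    rw [e]
    exact fil_mul ih hf

lemma wc_hom (j : ℕ) (f : MvPolynomial (Fin n) k) : IsWeightedHomogeneous w (wc w j f) j :=
  weightedHomogeneousComponent_isWeightedHomogeneous j f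

lemma coeff_wc (j : ℕ) (f : MvPolynomial (Fin n) k) (a) :
    (wc w j f).coeff a = if Finsupp.weight w a = j then f.coeff a else 0 := by
  classical
  exact coeff_weightedHomogeneousComponent ..

lemma fil_sub_wc {j : ℕ} {f : MvPolynomial (Fin n) k} (hf : f ∈ Fil w j) :
    f - wc w j f ∈ Fil w ((j : ℤ) - 1) := by
  intro a ha
  rw [coeff_sub, coeff_wc] at ha
  split_ifs at ha with h
  · simp at ha
  · have := hf a (by simpa using ha)
    omega

lemma fil_exists (f : MvPolynomial (Fin n) k) : ∃ j : ℕ, f ∈ Fil w j := by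
  refine ⟨f.support.sup (fun a => Finsupp.weight w a), fun a ha => ?_⟩
  exact_mod_cast Finset.le_sup (f := fun a => Finsupp.weight w a) (by simpa using ha)

lemma wc_zero_of_fil {j : ℤ} {i : ℕ} (h : j < i) {f : MvPolynomial (Fin n) k} (hf : f ∈ Fil w j) :
    wc w i f = 0 := by
  ext a
  rw [coeff_wc]
  split_ifs with h1
  · by_contra h2
    have := hf a (by simpa using h2)
    omega
  · simp

lemma fil_of_wc {j : ℤ} {f : MvPolynomial (Fin n) k} (h : ∀ i : ℕ, j < i → wc w i f = 0) :
    f ∈ Fil w j := by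
  intro a ha
  by_contra h1
  have := h (Finsupp.weight w a) (by omega)
  apply ha
  have h2 := congrArg (coeff a) this
  rw [coeff_wc] at h2
  simpa using h2

lemma wc_mul_hom {D i : ℕ} {g : MvPolynomial (Fin n) k} (hg : IsWeightedHomogeneous w g D)
    (f : MvPolynomial (Fin n) k) : wc w (D + i) (g * f) = g * wc w i f := by
  classical
  ext a
  rw [coeff_wc, coeff_mul, coeff_mul]
  split_ifs with h
  · apply Finset.sum_congr rfl
    intro x hx
    rw [coeff_wc]
    split_ifs with h1
    · rfl
    · by_cases h2 : coeff x.1 g = 0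
      · simp [h2]
      · exfalso
        have h3 := hg h2
        have : x.1 + x.2 = a := by simpa using hx
        rw [← this, map_add] at h
        omega
  · symm
    apply Finset.sum_eq_zero
    intro x hx
    rw [coeff_wc]
    split_ifs with h1
    · by_cases h2 : coeff x.1 g = 0
      · simp [h2]
      · exfalso
        have h3 := hg h2
        have : x.1 + x.2 = a := by simpa using hx
        rw [← this, map_add] at h
        omega
    · simp

lemma wc_mul_hom' {D j : ℕ} {g : MvPolynomial (Fin n) k} (hg : IsWeightedHomogeneous w g D)
    (f : MvPolynomial (Fin n) k) (h : j < D) : wc w j (g * f) = 0 := by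
  classical
  ext a
  rw [coeff_wc, coeff_mul]
  split_ifs with h'
  · rw [coeff_zero]
    apply Finset.sum_eq_zero
    intro x hx
    by_cases h2 : coeff x.1 g = 0
    · simp [h2]
    · exfalso
      have h3 := hg h2
      have : x.1 + x.2 = a := by simpa using hx
      rw [← this, map_add] at h'
      omega
  · simp

lemma fil_div {D : ℕ} {j : ℤ} {g f : MvPolynomial (Fin n) k} (hg : IsWeightedHomogeneous w g D)
    (h0 : g ≠ 0) (h : g * f ∈ Fil w (D + j)) : f ∈ Fil w j := by
  apply fil_of_wc
  intro i hi
  have := wc_zero_of_fil (i := D + i) (by push_cast; omega) h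
  rw [wc_mul_hom hg] at this
  exact (mul_eq_zero.mp this).resolve_left h0

lemma wc_same {j : ℕ} {f : MvPolynomial (Fin n) k} (h : IsWeightedHomogeneous w f j) :
    wc w j f = f := weightedHomogeneousComponent_eq_self h

lemma wc_ne {i j : ℕ} {f : MvPolynomial (Fin n) k} (h : IsWeightedHomogeneous w f j) (hij : i ≠ j) :
    wc w i f = 0 := h.weightedHomogeneousComponent_ne i hij

lemma sum_wc {J : ℕ} {f : MvPolynomial (Fin n) k} (h : f ∈ Fil w J) :
    f = ∑ i ∈ Finset.range (J + 1), wc w i f := by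
  classical
  ext a
  rw [coeff_sum]
  simp_rw [coeff_wc]
  rw [Finset.sum_ite_eq]
  split_ifs with h1
  · rfl
  · by_contra h2
    have := h a h2
    simp at h1
    omega

lemma wc_mul_top {i j : ℕ} {f g : MvPolynomial (Fin n) k} (hf : f ∈ Fil w i) (hg : g ∈ Fil w j) :
    wc w (i + j) (f * g) = wc w i f * wc w j g := by
  have : f * g = wc w i f * g + (f - wc w i f) * g := by ring
  rw [this, wc, map_add]
  have h2 : weightedHomogeneousComponent w (i+j) ((f - wc w i f) * g) = 0 :=
    wc_zero_of_fil (j := (i:ℤ) - 1 + j) (by push_cast; omega) (fil_mul (fil_sub_wc hf) hg)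
  rw [h2, add_zero]
  exact wc_mul_hom (wc_hom _ _) _

/-- homogeneous ideals -/
def HI (w : Fin n → ℕ) (J : Ideal (MvPolynomial (Fin n) k)) : Prop :=
  ∀ f ∈ J, ∀ j, wc w j f ∈ J

lemma HI.iff {J : Ideal (MvPolynomial (Fin n) k)} :
    letI := weightedGradedAlgebra k w
    HI w J ↔ J.IsHomogeneous (weightedHomogeneousSubmodule k w) := by
  letI := weightedGradedAlgebra k w
  constructor
  · intro h i f hf
    have := h f hf i
    rw [wc, ← weightedDecomposition.decompose'_apply] at this
    exact this
  · intro h f hf j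
    exact weightedHomogeneousComponent_mem_of_mem k w h hf j

lemma HI.sup {J K : Ideal (MvPolynomial (Fin n) k)} (hJ : HI w J) (hK : HI w K) : HI w (J ⊔ K) := by
  letI := weightedGradedAlgebra k w
  rw [HI.iff] at *
  exact hJ.sup hK

lemma HI.mul {J K : Ideal (MvPolynomial (Fin n) k)} (hJ : HI w J) (hK : HI w K) : HI w (J * K) := by
  letI := weightedGradedAlgebra k w
  rw [HI.iff] at *
  exact hJ.mul hK

lemma HI.top : HI w (⊤ : Ideal (MvPolynomial (Fin n) k)) := fun _ _ _ => trivial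

lemma HI.pow {J : Ideal (MvPolynomial (Fin n) k)} (hJ : HI w J) (m : ℕ) : HI w (J ^ m) := by
  induction m with
  | zero => simpa using HI.top
  | succ m ih => rw [pow_succ]; exact ih.mul hJ

lemma HI.radical {J : Ideal (MvPolynomial (Fin n) k)} (hJ : HI w J) : HI w J.radical := by
  letI := weightedGradedAlgebra k w
  rw [HI.iff] at *
  exact hJ.radical

lemma HI.sInf {s : Set (Ideal (MvPolynomial (Fin n) k))} (h : ∀ J ∈ s, HI w J) : HI w (sInf s) := by
  intro f hf j
  rw [Submodule.mem_sInf] at *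
  exact fun J hJ => h J hJ f (hf J hJ) j

lemma HI.span {s : Set (MvPolynomial (Fin n) k)} (h : ∀ f ∈ s, ∃ j, IsWeightedHomogeneous w f j) :
    HI w (Ideal.span s) := by
  letI := weightedGradedAlgebra k w
  rw [HI.iff]
  apply Ideal.homogeneous_span
  intro f hf
  obtain ⟨j, hj⟩ := h f hf
  exact ⟨j, hj⟩

lemma exists_core (q : Ideal (MvPolynomial (Fin n) k)) (hq : q.IsPrime) :
    ∃ q' : Ideal (MvPolynomial (Fin n) k), q'.IsPrime ∧ HI w q' ∧ q' ≤ q ∧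
      ∀ J, HI w J → J ≤ q → J ≤ q' := by
  letI := weightedGradedAlgebra k w
  refine ⟨(q.homogeneousCore (weightedHomogeneousSubmodule k w)).toIdeal, hq.homogeneousCore, ?_, ?_, ?_⟩
  · rw [HI.iff]; exact HomogeneousIdeal.isHomogeneous _
  · exact Ideal.toIdeal_homogeneousCore_le _ _
  · intro J hJ hle
    rw [HI.iff] at hJ
    have := (Ideal.homogeneousCore.gi (weightedHomogeneousSubmodule k w)).gc ⟨J, hJ⟩ q
    exact this.mp hle

lemma HI.minimalPrimes {J q : Ideal (MvPolynomial (Fin n) k)} (hJ : HI w J)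
    (hq : q ∈ J.minimalPrimes) : HI w q := by
  obtain ⟨q', h1, h2, h3, h4⟩ := exists_core (w := w) q hq.1.1
  have := hq.2 ⟨h1, h4 J hJ hq.1.2⟩ h3
  rwa [le_antisymm this h3]

/-- a homogeneous ideal not contained in q has a homogeneous element outside q -/
lemma HI.exists_notMem {J q : Ideal (MvPolynomial (Fin n) k)} (hJ : HI w J) (h : ¬ J ≤ q) :
    ∃ f ∈ J, f ∉ q ∧ ∃ j, IsWeightedHomogeneous w f j := by
  obtain ⟨f, hf, hfq⟩ := Set.not_subset.mp h
  obtain ⟨D, hD⟩ := fil_exists (w := w) f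
  by_contra hcon
  push Not at hcon
  apply hfq
  rw [sum_wc hD]
  refine Submodule.sum_mem q fun i _ => ?_
  by_contra h3
  exact hcon _ (hJ f hf i) h3 i (wc_hom _ _)

end FilSec
end Wrap1

section Wrap2
open MvPolynomial
section InSec
variable {k : Type} [Field k] {n : ℕ} {w : Fin n → ℕ}

lemma wc_mul (j : ℕ) (f g : MvPolynomial (Fin n) k) :
    wc w j (f * g) = ∑ i ∈ Finset.range (j + 1), wc w i f * wc w (j - i) g := by
  obtain ⟨J, hJ⟩ := fil_exists (w := w) f
  have hJ' : f ∈ Fil w ((J + j : ℕ) : ℤ) := fil_mono (by push_cast; omega) hJ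
  conv_lhs => rw [sum_wc hJ', Finset.sum_mul, wc, map_sum]
  rw [← Finset.sum_subset (s₁ := Finset.range (j + 1))]
  · apply Finset.sum_congr rfl
    intro i hi
    have : j = i + (j - i) := by simp at hi; omega
    conv_lhs => rw [this]
    exact wc_mul_hom (wc_hom _ _) _
  · intro i hi
    simp at *; omega
  · intro i _ hi
    exact wc_mul_hom' (wc_hom _ _) _ (by simpa using hi)

lemma low_mul_aux {J : Ideal (MvPolynomial (Fin n) k)} {N M : ℕ} {f g : MvPolynomial (Fin n) k}
    (hf : ∀ j : ℕ, ∃ f' ∈ Fil w ((j : ℤ) - N), wc w j f - f' ∈ J)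
    (hg : ∀ j : ℕ, ∃ f' ∈ Fil w ((j : ℤ) - M), wc w j g - f' ∈ J) (j : ℕ) :
    ∃ f' ∈ Fil w ((j : ℤ) - (N + M : ℕ)), wc w j (f * g) - f' ∈ J := by
  choose a ha ha' using hf
  choose b hb hb' using hg
  refine ⟨∑ i ∈ Finset.range (j + 1), a i * b (j - i), ?_, ?_⟩
  · refine Submodule.sum_mem _ fun i hi => ?_
    refine fil_mono ?_ (fil_mul (ha i) (hb (j - i)))
    simp at hi
    have : ((j - i : ℕ) : ℤ) = j - i := by omega
    push_cast; omega
  · rw [wc_mul, ← Finset.sum_sub_distrib]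
    refine Submodule.sum_mem _ fun i hi => ?_
    have : wc w i f * wc w (j - i) g - a i * b (j - i) =
      wc w (j - i) g * (wc w i f - a i) + a i * (wc w (j - i) g - b (j - i)) := by ring
    rw [this]
    exact J.add_mem (J.mul_mem_left _ (ha' i)) (J.mul_mem_left _ (hb' _))

/-- elements whose homogeneous parts drop by `N` degrees modulo `J` -/
def LowI (w : Fin n → ℕ) (J : Ideal (MvPolynomial (Fin n) k)) (N : ℕ) :
    Ideal (MvPolynomial (Fin n) k) where
  carrier := {f | ∀ j : ℕ, ∃ f' ∈ Fil w ((j : ℤ) - N), wc w j f - f' ∈ J}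
  zero_mem' := fun j => ⟨0, Submodule.zero_mem _, by simp⟩
  add_mem' := by
    intro f g hf hg j
    obtain ⟨a, ha, ha'⟩ := hf j
    obtain ⟨b, hb, hb'⟩ := hg j
    refine ⟨a + b, Submodule.add_mem _ ha hb, ?_⟩
    have : wc w j (f + g) - (a + b) = (wc w j f - a) + (wc w j g - b) := by
      rw [wc, map_add]; ring
    rw [this]
    exact J.add_mem ha' hb'
  smul_mem' := by
    intro c f hf j
    have := low_mul_aux (N := 0) (f := c)
      (fun j => ⟨wc w j c, by simpa using fil_of_hom (wc_hom _ _), by simp⟩) hf j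
    simpa using this

lemma lowI_mul {J : Ideal (MvPolynomial (Fin n) k)} {N M : ℕ} :
    LowI w J N * LowI w J M ≤ LowI w J (N + M) := by
  rw [Ideal.mul_le]
  intro f hf g hg j
  exact low_mul_aux hf hg j

lemma lowI_pow {J : Ideal (MvPolynomial (Fin n) k)} (N : ℕ) :
    LowI w J 1 ^ N ≤ LowI w J N := by
  induction N with
  | zero =>
    intro f _ j
    exact ⟨wc w j f, by simpa using fil_of_hom (wc_hom _ _), by simp⟩
  | succ N ih =>
    rw [pow_succ]
    exact (Ideal.mul_mono ih le_rfl).trans lowI_mul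

lemma weight_eq (a : Fin n →₀ ℕ) : Finsupp.weight w a = ∑ i, w i * a i := by
  rw [Finsupp.weight_apply, Finsupp.sum_fintype _ _ (by simp)]
  simp [mul_comm]

lemma initialForm_eq (f : MvPolynomial (Fin n) k) : initialForm w f = wc w (wDeg w f) f := by
  classical
  ext a
  rw [coeff_wc, initialForm, coeff_sum]
  simp_rw [coeff_monomial, weight_eq]
  rw [Finset.sum_ite_eq']
  simp only [Finset.mem_filter, mem_support_iff]
  by_cases h : coeff a f = 0 <;> simp [h]

lemma fil_wDeg (f : MvPolynomial (Fin n) k) : f ∈ Fil w (wDeg w f) := by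
  intro a ha
  rw [weight_eq]
  exact_mod_cast Finset.le_sup (s := f.support) (f := fun a : Fin n →₀ ℕ => ∑ i, w i * a i)
    (mem_support_iff.mpr ha)

lemma wc_mem_initialIdeal {J : Ideal (MvPolynomial (Fin n) k)} {f : MvPolynomial (Fin n) k}
    (hf : f ∈ J) {j : ℕ} (hj : f ∈ Fil w j) : wc w j f ∈ initialIdeal w J := by
  by_cases h0 : f = 0
  · subst h0; simp [wc]
  by_cases h : wDeg w f = j
  · subst h
    apply Ideal.subset_span
    exact ⟨f, hf, h0, (initialForm_eq f).symm⟩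
  · have : wDeg w f < j := by
      refine lt_of_le_of_ne ?_ h
      apply Finset.sup_le
      intro a ha
      have := hj a (by simpa using ha)
      rw [weight_eq] at this
      exact_mod_cast this
    rw [wc_zero_of_fil (by exact_mod_cast this) (fil_wDeg f)]
    simp

lemma HI_initialIdeal (J : Ideal (MvPolynomial (Fin n) k)) : HI w (initialIdeal w J) := by
  apply HI.span
  rintro f ⟨g, hg, h0, rfl⟩
  exact ⟨wDeg w g, by rw [initialForm_eq]; exact wc_hom _ _⟩

lemma initialIdeal_le_low (J : Ideal (MvPolynomial (Fin n) k)) : initialIdeal w J ≤ LowI w J 1 := by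
  rw [initialIdeal, Ideal.span_le]
  rintro f ⟨g, hg, h0, rfl⟩ j
  rw [initialForm_eq]
  by_cases h : j = wDeg w g
  · subst h
    rw [wc_same (wc_hom _ _)]
    refine ⟨wc w (wDeg w g) g - g, ?_, by rw [sub_sub_cancel]; exact hg⟩
    rw [← neg_sub g]
    refine (Submodule.neg_mem_iff _).mpr ?_
    exact_mod_cast fil_sub_wc (w := w) (fil_wDeg g)
  · rw [wc_ne (wc_hom _ _) h]
    exact ⟨0, Submodule.zero_mem _, by simp⟩

lemma initialIdeal_mono {J K : Ideal (MvPolynomial (Fin n) k)} (h : J ≤ K) :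
    initialIdeal w J ≤ initialIdeal w K := by
  apply Ideal.span_mono
  rintro f ⟨g, hg, h0, rfl⟩
  exact ⟨g, h hg, h0, rfl⟩

lemma initialIdeal_mul (J K : Ideal (MvPolynomial (Fin n) k)) :
    initialIdeal w J * initialIdeal w K ≤ initialIdeal w (J ⊓ K) := by
  rw [initialIdeal, initialIdeal, Ideal.span_mul_span', Ideal.span_le]
  rintro x ⟨_, ⟨f, hf, h0, rfl⟩, _, ⟨g, hg, h0', rfl⟩, rfl⟩
  simp only
  rw [initialForm_eq, initialForm_eq, ← wc_mul_top (fil_wDeg f) (fil_wDeg g)]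
  apply wc_mem_initialIdeal
  · exact ⟨J.mul_mem_right _ hf, K.mul_mem_left _ hg⟩
  · push_cast
    exact fil_mul (fil_wDeg f) (fil_wDeg g)

lemma wc_pow_top {i : ℕ} {f : MvPolynomial (Fin n) k} (hf : f ∈ Fil w i) (m : ℕ) :
    wc w (m * i) (f ^ m) = (wc w i f) ^ m := by
  induction m with
  | zero => simpa using wc_same (isWeightedHomogeneous_one k w)
  | succ m ih =>
    rw [pow_succ, pow_succ, ← ih, Nat.succ_mul]
    apply wc_mul_top _ hf
    push_cast
    exact fil_pow hf m

lemma initialIdeal_radical (J : Ideal (MvPolynomial (Fin n) k)) :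
    initialIdeal w J.radical ≤ (initialIdeal w J).radical := by
  conv_lhs => rw [initialIdeal]
  rw [Ideal.span_le]
  rintro _ ⟨f, ⟨m, hm⟩, h0, rfl⟩
  refine ⟨m, ?_⟩
  rw [initialForm_eq, ← wc_pow_top (fil_wDeg f)]
  apply wc_mem_initialIdeal hm
  push_cast
  exact fil_pow (fil_wDeg f) m

lemma initialIdeal_ne_top {J : Ideal (MvPolynomial (Fin n) k)} (h : J ≠ ⊤) :
    initialIdeal w J ≠ ⊤ := by
  intro h1
  have h2 : (1 : MvPolynomial (Fin n) k) ∈ initialIdeal w J := by rw [h1]; trivial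
  obtain ⟨f', hf, hf'⟩ := initialIdeal_le_low J h2 0
  rw [fil_neg (by simp) hf, wc_same (isWeightedHomogeneous_one k w), sub_zero] at hf'
  exact h ((Ideal.eq_top_iff_one _).mpr hf')

/-- `b ⊆ √in(p_j)` for all j in a finite set gives `b ⊆ √in(⋂ p_j)` -/
lemma le_radical_initialIdeal_sInf {s : Set (Ideal (MvPolynomial (Fin n) k))} (hs : s.Finite)
    {b : Ideal (MvPolynomial (Fin n) k)} (h : ∀ p ∈ s, b ≤ (initialIdeal w p).radical) :
    b ≤ (initialIdeal w (sInf s)).radical := by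
  induction s, hs using Set.Finite.induction_on with
  | empty =>
    rw [sInf_empty]
    refine le_trans ?_ Ideal.le_radical
    intro f _
    have : (1 : MvPolynomial (Fin n) k) ∈ initialIdeal w ⊤ := by
      have := wc_mem_initialIdeal (w := w) (J := (⊤ : Ideal (MvPolynomial (Fin n) k)))
        (f := 1) (j := 0) trivial (by simpa using fil_one)
      rwa [wc_same (isWeightedHomogeneous_one k w)] at this
    rw [(Ideal.eq_top_iff_one _).mpr this]; trivial
  | @insert p s _ _ ih =>
    rw [sInf_insert]
    have h1 := h p (by simp)
    have h2 := ih (fun q hq => h q (by simp [hq]))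
    calc b ≤ (initialIdeal w p).radical ⊓ (initialIdeal w (sInf s)).radical := le_inf h1 h2
      _ = (initialIdeal w p * initialIdeal w (sInf s)).radical := (Ideal.radical_mul _ _).symm
      _ ≤ _ := Ideal.radical_mono (initialIdeal_mul _ _)
end InSec
end Wrap2

section Wrap3
section DimSec

lemma dim_drop {R : Type*} [CommRing R] {J J' : Ideal R} (hJ : J ≤ J')
    (h : ∀ q ∈ J.minimalPrimes, ¬ J' ≤ q) :
    ringKrullDim (R ⧸ J') + 1 ≤ ringKrullDim (R ⧸ J) := by
  by_cases hr' : J' = ⊤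
  · have : Subsingleton (R ⧸ J') := Ideal.Quotient.subsingleton_iff.mpr hr'
    rw [ringKrullDim_eq_bot_of_subsingleton]
    simp
  have n1 : Nonempty (PrimeSpectrum.zeroLocus (R := R) J') := by
    rwa [Set.nonempty_coe_sort, Set.nonempty_iff_ne_empty, ne_eq,
      PrimeSpectrum.zeroLocus_empty_iff_eq_top]
  have n2 : Nonempty (PrimeSpectrum.zeroLocus (R := R) J) := by
    obtain ⟨x, hx⟩ := n1
    exact ⟨x, le_trans hJ hx⟩
  rw [ringKrullDim_quotient, Order.krullDim_eq_iSup_length, ringKrullDim_quotient,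
    Order.krullDim_eq_iSup_length, ← WithBot.coe_one, ← WithBot.coe_add,
    ENat.iSup_add, WithBot.coe_le_coe, iSup_le_iff]
  intro l
  have hl : J' ≤ l.head.1.asIdeal := l.head.2
  obtain ⟨p, hp, hp'⟩ := Ideal.exists_minimalPrimes_le (hJ.trans hl)
  let p' : PrimeSpectrum.zeroLocus (R := R) J := ⟨⟨p, hp.1.1⟩, hp.1.2⟩
  let φ : PrimeSpectrum.zeroLocus (R := R) J' → PrimeSpectrum.zeroLocus (R := R) J :=
    fun x => ⟨x.1, le_trans hJ x.2⟩
  have hφ : StrictMono φ := fun _ _ h => h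
  have hp'' : p' < (l.map φ hφ).head := by
    refine lt_of_le_of_ne ?_ ?_
    · exact hp'
    · intro h1
      apply h p hp
      have h2 : p = l.head.1.asIdeal := by
        have := congrArg (fun x => x.1.asIdeal) h1
        exact this
      rwa [h2]
  refine le_trans ?_ (le_iSup _ ((l.map φ hφ).cons p' hp''))
  simp

lemma dim_integral_le {A B : Type*} [CommRing A] [CommRing B] [Algebra A B]
    [Algebra.IsIntegral A B] : ringKrullDim B ≤ ringKrullDim A := by
  apply Order.krullDim_le_of_strictMono (PrimeSpectrum.comap (algebraMap A B))
  intro x y hxy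
  exact Ideal.IsIntegral.comap_lt_comap (R := A) (I := x.asIdeal) (J := y.asIdeal) hxy

lemma dim_le_integral {A B : Type*} [CommRing A] [CommRing B] [Algebra A B]
    [Algebra.IsIntegral A B] (h : Function.Injective (algebraMap A B)) :
    ringKrullDim A ≤ ringKrullDim B := by
  rw [ringKrullDim, Order.krullDim]
  apply iSup_le
  intro l
  obtain ⟨Q, -, hQ, hQ'⟩ := Ideal.exists_ideal_over_prime_of_isIntegral (S := B)
    (RelSeries.head l).asIdeal (⊥ : Ideal B) (by
      rw [← RingHom.ker_eq_comap_bot, (RingHom.injective_iff_ker_eq_bot _).mp h]; exact bot_le)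
  have : Q.LiesOver (RelSeries.head l).asIdeal := (Ideal.liesOver_iff _ _).mpr hQ'.symm
  obtain ⟨L, hL, -⟩ := Ideal.exists_ltSeries_of_hasGoingUp (S := B) l Q
  rw [← hL]
  exact le_iSup (fun p : LTSeries (PrimeSpectrum B) => (p.length : WithBot ℕ∞)) L

open MvPolynomial in
lemma height_max {k : Type} [Field k] {m : ℕ} (M : Ideal (MvPolynomial (Fin m) k)) [hM : M.IsMaximal] :
    M.height = m := by
  induction m with
  | zero =>
    have h1 := Ideal.height_le_ringKrullDim_of_ne_top hM.ne_top
    rw [MvPolynomial.ringKrullDim_of_isNoetherianRing, ringKrullDim_eq_zero_of_field] at h1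
    simp at h1
    simp [h1]
  | succ m ih =>
    let e := (finSuccEquiv k m).toRingEquiv
    let M' : Ideal (Polynomial (MvPolynomial (Fin m) k)) := M.map e
    have : M'.IsMaximal := Ideal.map_isMaximal_of_equiv e
    have hM' : M'.height = M.height := RingEquiv.height_map e M
    have h1 : (M'.comap (Polynomial.C)).IsMaximal := Polynomial.isMaximal_comap_C_of_isJacobsonRing M'
    have : M'.LiesOver (Ideal.comap Polynomial.C M') := ⟨rfl⟩
    rw [← hM', Polynomial.height_eq_height_add_one (M'.comap Polynomial.C) M', ih]
    simp

lemma dim_integral_le' {A B : Type*} [CommRing A] [CommRing B] (f : A →+* B)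
    (hf : f.IsIntegral) : ringKrullDim B ≤ ringKrullDim A := by
  algebraize [f]
  exact dim_integral_le

lemma dim_le_integral' {A B : Type*} [CommRing A] [CommRing B] (f : A →+* B)
    (hf : f.IsIntegral) (h : Function.Injective f) : ringKrullDim A ≤ ringKrullDim B := by
  algebraize [f]
  exact dim_le_integral h

lemma dim_mv {k : Type} [Field k] (m : ℕ) : ringKrullDim (MvPolynomial (Fin m) k) = m := by
  rw [MvPolynomial.ringKrullDim_of_isNoetherianRing, ringKrullDim_eq_zero_of_field]
  simp

lemma dim_quot_mv {k : Type} [Field k] {m : ℕ} {f : MvPolynomial (Fin m) k} (hf : ¬ IsUnit f) :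
    (m : WithBot ℕ∞) ≤ ringKrullDim (MvPolynomial (Fin m) k ⧸ Ideal.span {f}) + 1 := by
  obtain ⟨M, hM, hfM⟩ := exists_max_ideal_of_mem_nonunits hf
  have := Ideal.height_le_ringKrullDim_quotient_add_one hfM
  rwa [height_max] at this

lemma dim_quot_lt {R : Type*} [CommRing R] [IsDomain R] {J : Ideal R} (hJ : J ≠ ⊥) :
    ringKrullDim (R ⧸ J) + 1 ≤ ringKrullDim R := by
  have h := dim_drop (J := (⊥ : Ideal R)) (J' := J) bot_le (by
    intro q hq hJq
    exact hJ (le_bot_iff.mp (hJq.trans (hq.2 ⟨Ideal.isPrime_bot, le_rfl⟩ bot_le))))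
  rwa [ringKrullDim_eq_of_ringEquiv (RingEquiv.quotientBot R)] at h

lemma dim_mv_quot_lt {k : Type} [Field k] {m : ℕ} {J : Ideal (MvPolynomial (Fin m) k)} (hJ : J ≠ ⊥) :
    ringKrullDim (MvPolynomial (Fin m) k ⧸ J) + 1 ≤ m := by
  have := dim_quot_lt hJ
  rwa [dim_mv] at this

end DimSec
end Wrap3

section Wrap4
open MvPolynomial
section AvoidSec
variable {k : Type} [Field k] {n : ℕ} {w : Fin n → ℕ}

lemma weight_zero (hw : ∀ i, 0 < w i) {a : Fin n →₀ ℕ} (h : Finsupp.weight w a = 0) : a = 0 := by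
  rw [weight_eq] at h
  ext i
  have := Finset.sum_eq_zero_iff.mp h i (Finset.mem_univ i)
  have h2 := hw i
  rcases Nat.mul_eq_zero.mp this with h3 | h3
  · omega
  · simpa using h3

lemma hom_zero (hw : ∀ i, 0 < w i) {f : MvPolynomial (Fin n) k} (hf : IsWeightedHomogeneous w f 0) :
    f = C (coeff 0 f) := by
  classical
  ext a
  rw [coeff_C]
  split_ifs with h
  · rw [h]
  · by_contra h2
    exact h (weight_zero hw (hf h2)).symm

lemma hom_zero_top (hw : ∀ i, 0 < w i) {f : MvPolynomial (Fin n) k} (hf : IsWeightedHomogeneous w f 0)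
    (h0 : f ≠ 0) {J : Ideal (MvPolynomial (Fin n) k)} (hJ : f ∈ J) : J = ⊤ := by
  apply Ideal.eq_top_of_isUnit_mem J hJ
  rw [hom_zero hw hf]
  apply IsUnit.map
  rw [isUnit_iff_ne_zero]
  intro h
  apply h0
  rw [hom_zero hw hf, h, map_zero]

lemma hom_avoid_aux (hw : ∀ i, 0 < w i) {J : Ideal (MvPolynomial (Fin n) k)} (hJ : HI w J)
    (N : ℕ) : ∀ S : Finset (Ideal (MvPolynomial (Fin n) k)), S.card = N →
    (∀ q ∈ S, q.IsPrime ∧ HI w q ∧ ¬ J ≤ q) →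
    ∃ f ∈ J, (∃ j, IsWeightedHomogeneous w f j) ∧ ∀ q ∈ S, f ∉ q := by
  classical
  induction N with
  | zero =>
    intro S hS _
    rw [Finset.card_eq_zero] at hS
    subst hS
    exact ⟨0, J.zero_mem, ⟨0, isWeightedHomogeneous_zero k w 0⟩, by simp⟩
  | succ N ih =>
    intro S hS h
    by_cases hT : J = ⊤
    · refine ⟨1, by simp [hT], ⟨0, isWeightedHomogeneous_one k w⟩, ?_⟩
      intro q hq h1
      exact (h q hq).1.ne_top ((Ideal.eq_top_iff_one _).mpr h1)
    by_cases hanti : ∃ q ∈ S, ∃ q' ∈ S, q' < q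
    · obtain ⟨q, hq, q', hq', hlt⟩ := hanti
      obtain ⟨f, hf, hom, hav⟩ := ih (S.erase q') (by rw [Finset.card_erase_of_mem hq', hS]; rfl)
        (fun x hx => h x (Finset.mem_of_mem_erase hx))
      refine ⟨f, hf, hom, fun x hx hfx => ?_⟩
      by_cases hxq : x = q'
      · subst hxq
        exact hav q (Finset.mem_erase.mpr ⟨hlt.ne', hq⟩) (hlt.le hfx)
      · exact hav x (Finset.mem_erase.mpr ⟨hxq, hx⟩) hfx
    · push Not at hanti
      obtain ⟨q, hq⟩ : S.Nonempty := by rw [← Finset.card_pos, hS]; omega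
      obtain ⟨f, hf, ⟨a, hom⟩, hav⟩ := ih (S.erase q) (by rw [Finset.card_erase_of_mem hq, hS]; rfl)
        (fun x hx => h x (Finset.mem_of_mem_erase hx))
      by_cases hfq : f ∉ q
      · refine ⟨f, hf, ⟨a, hom⟩, fun x hx => ?_⟩
        by_cases hxq : x = q
        · rwa [hxq]
        · exact hav x (Finset.mem_erase.mpr ⟨hxq, hx⟩)
      push Not at hfq
      have hq1 := (h q hq).1
      have hni : ¬ (insert J (S.erase q)).inf id ≤ q := by
        rw [Ideal.IsPrime.inf_le' hq1]
        rintro ⟨x, hx, hxq⟩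
        rcases Finset.mem_insert.mp hx with rfl | hx
        · exact (h q hq).2.2 hxq
        · have hx2 := Finset.mem_erase.mp hx
          exact hanti q hq x hx2.2 (lt_of_le_of_ne hxq hx2.1)
      have hHI : HI w ((insert J (S.erase q)).inf id) := by
        rw [Finset.inf_id_eq_sInf]
        apply HI.sInf
        intro x hx
        rcases Finset.mem_insert.mp (Finset.mem_coe.mp hx) with rfl | hx
        · exact hJ
        · exact (h x (Finset.mem_of_mem_erase hx)).2.1
      obtain ⟨g, hg, hgq, b, hgb⟩ := hHI.exists_notMem hni
      have hgx : ∀ x ∈ insert J (S.erase q), g ∈ x := fun x hx =>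
        (Finset.inf_le (f := id) hx) hg
      have hgJ : g ∈ J := hgx J (Finset.mem_insert_self _ _)
      have hb : b ≠ 0 := by
        rintro rfl
        exact hT (hom_zero_top hw hgb (by rintro rfl; exact hgq q.zero_mem) hgJ)
      by_cases ha : a = 0
      · subst ha
        by_cases hf0 : f = 0
        · refine ⟨g, hgJ, ⟨b, hgb⟩, fun x hx => ?_⟩
          by_cases hxq : x = q
          · rwa [hxq]
          · exact absurd (hf0 ▸ x.zero_mem) (hav x (Finset.mem_erase.mpr ⟨hxq, hx⟩))
        · exact absurd (hom_zero_top hw hom hf0 hf) hT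
      refine ⟨f ^ b + g ^ a, J.add_mem (J.pow_mem_of_mem hf _ (by omega))
        (J.pow_mem_of_mem hgJ _ (by omega)), ⟨b * a, ?_⟩, fun x hx hmem => ?_⟩
      · have e1 := hom.pow b
        have e2 := hgb.pow a
        simp only [smul_eq_mul] at e1 e2
        rw [mul_comm a b] at e2
        exact e1.add e2
      · by_cases hxq : x = q
        · subst hxq
          have : g ^ a ∈ x := (Ideal.add_mem_iff_right x (x.pow_mem_of_mem hfq _ (by omega))).mp hmem
          exact hgq (hq1.mem_of_pow_mem _ this)
        · have hx' := Finset.mem_erase.mpr ⟨hxq, hx⟩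
          have h2 := hgx x (Finset.mem_insert_of_mem hx')
          have : f ^ b ∈ x := (Ideal.add_mem_iff_left x (x.pow_mem_of_mem h2 _ (by omega))).mp hmem
          exact hav x hx' ((h x hx).1.mem_of_pow_mem _ this)

lemma hom_avoid (hw : ∀ i, 0 < w i) {J : Ideal (MvPolynomial (Fin n) k)} (hJ : HI w J)
    {S : Set (Ideal (MvPolynomial (Fin n) k))} (hS : S.Finite)
    (h : ∀ q ∈ S, q.IsPrime ∧ ¬ J ≤ q) :
    ∃ f ∈ J, (∃ j, IsWeightedHomogeneous w f j) ∧ ∀ q ∈ S, f ∉ q := by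
  classical
  have h' : ∀ q, ∃ q' : Ideal (MvPolynomial (Fin n) k), q ∈ S → q'.IsPrime ∧ HI w q' ∧ q' ≤ q ∧
      ∀ J, HI w J → J ≤ q → J ≤ q' := by
    intro q
    by_cases hq : q ∈ S
    · obtain ⟨q', h⟩ := exists_core (w := w) q (h q hq).1
      exact ⟨q', fun _ => h⟩
    · exact ⟨⊥, fun h => absurd h hq⟩
  choose φ hφ using h'
  obtain ⟨f, hf, ⟨j, hom⟩, hav⟩ := hom_avoid_aux hw hJ _ (hS.toFinset.image φ) rfl (by
    intro q hq
    obtain ⟨x, hx, rfl⟩ := Finset.mem_image.mp hq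
    have hx' : x ∈ S := by simpa using hx
    obtain ⟨h1, h2, h3, h4⟩ := hφ x hx'
    exact ⟨h1, h2, fun hle => (h x hx').2 (hle.trans h3)⟩)
  refine ⟨f, hf, ⟨j, hom⟩, fun q hq hfq => ?_⟩
  obtain ⟨h1, h2, h3, h4⟩ := hφ q hq
  apply hav (φ q) (Finset.mem_image.mpr ⟨q, by simpa using hq, rfl⟩)
  exact h4 (Ideal.span {f}) (HI.span (by rintro _ rfl; exact ⟨j, hom⟩))
    ((Ideal.span_singleton_le_iff_mem _).mpr hfq) (Ideal.mem_span_singleton_self f)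

/-- the irrelevant ideal -/
noncomputable def irr (k : Type) [Field k] (n : ℕ) : Ideal (MvPolynomial (Fin n) k) :=
  Ideal.span (Set.range X)

lemma coeff_irr {f : MvPolynomial (Fin n) k} (hf : f ∈ irr k n) : coeff 0 f = 0 := by
  have : irr k n ≤ RingHom.ker (constantCoeff (σ := Fin n) (R := k)) := by
    rw [irr, Ideal.span_le]
    rintro _ ⟨i, rfl⟩
    simp
  exact this hf

lemma irr_ne_top : irr k n ≠ ⊤ := by
  intro h
  have := coeff_irr (k := k) (n := n) (f := 1) (by rw [h]; trivial)
  simp at this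

lemma HI_irr : HI w (irr k n) := by
  apply HI.span
  rintro _ ⟨i, rfl⟩
  exact ⟨w i, isWeightedHomogeneous_X k w i⟩

lemma le_irr (hw : ∀ i, 0 < w i) {J : Ideal (MvPolynomial (Fin n) k)} (hJ : HI w J) (hT : J ≠ ⊤) :
    J ≤ irr k n := by
  intro f hf
  have h1 := hJ f hf 0
  have h2 : coeff 0 f = 0 := by
    by_contra h
    refine hT (hom_zero_top hw (wc_hom 0 f) ?_ h1)
    intro h3
    have := congrArg (coeff 0) h3
    rw [coeff_wc] at this
    simp at this
    exact h this
  rw [irr, ← Set.image_univ, mem_ideal_span_X_image]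
  intro a ha
  by_contra hcon
  push Not at hcon
  have : a = 0 := by ext i; simpa using hcon i
  subst this
  simp [h2] at ha

lemma exists_hsop (hw : ∀ i, 0 < w i) (G : Ideal (MvPolynomial (Fin n) k)) (hG : HI w G) (hT : G ≠ ⊤) :
    ∃ (m : ℕ) (y : Fin m → MvPolynomial (Fin n) k) (w' : Fin m → ℕ), (∀ i, 0 < w' i) ∧
      (∀ i, IsWeightedHomogeneous w (y i) (w' i)) ∧
      (∀ i, X i ∈ (G ⊔ Ideal.span (Set.range y)).radical) ∧
      (m : WithBot ℕ∞) ≤ ringKrullDim (MvPolynomial (Fin n) k ⧸ G) := by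
  induction G using WellFoundedGT.induction with
  | ind G ih =>
  by_cases hex : ∃ q ∈ G.minimalPrimes, irr k n ≤ q
  · obtain ⟨q, hq, hle⟩ := hex
    refine ⟨0, Fin.elim0, Fin.elim0, fun i => i.elim0, fun i => i.elim0, fun i => ?_, ?_⟩
    · refine Ideal.radical_mono le_sup_left ?_
      rw [← Ideal.sInf_minimalPrimes, Submodule.mem_sInf]
      intro q' hq'
      have h1 := le_irr hw (hG.minimalPrimes hq') hq'.1.1.ne_top
      have h2 := hq.2 hq'.1 (h1.trans hle)
      exact h2 (hle (Ideal.subset_span ⟨i, rfl⟩))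
    · have : Nontrivial (MvPolynomial (Fin n) k ⧸ G) := Ideal.Quotient.nontrivial_iff.mpr hT
      exact_mod_cast ringKrullDim_nonneg_of_nontrivial
  · push Not at hex
    obtain ⟨z, hz, ⟨δ, hzδ⟩, hav⟩ := hom_avoid hw (HI_irr (k := k)) (Ideal.finite_minimalPrimes_of_isNoetherianRing _ G)
      (fun q hq => ⟨hq.1.1, hex q hq⟩)
    obtain ⟨q0, hq0⟩ : G.minimalPrimes.Nonempty :=
      Set.nonempty_coe_sort.mp (Ideal.nonempty_minimalPrimes hT)
    have hδ : 0 < δ := by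
      rw [Nat.pos_iff_ne_zero]
      rintro rfl
      apply hav q0 hq0
      rw [hom_zero hw hzδ, coeff_irr hz, map_zero]
      exact q0.zero_mem
    have hG' : HI w (G ⊔ Ideal.span {z}) := hG.sup (HI.span (by rintro _ rfl; exact ⟨δ, hzδ⟩))
    have hlt : G < G ⊔ Ideal.span {z} := by
      refine lt_of_le_of_ne le_sup_left fun h => hav q0 hq0 (hq0.1.2 ?_)
      rw [h]
      exact Ideal.mem_sup_right (Ideal.mem_span_singleton_self z)
    have hT' : G ⊔ Ideal.span {z} ≠ ⊤ := by
      intro h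
      apply irr_ne_top (k := k) (n := n)
      rw [eq_top_iff, ← h]
      exact sup_le (le_irr hw hG hT) ((Ideal.span_singleton_le_iff_mem _).mpr hz)
    obtain ⟨m, y, w', h1, h2, h3, h4⟩ := ih _ hlt hG' hT'
    refine ⟨m + 1, Fin.cons z y, Fin.cons δ w', ?_, ?_, ?_, ?_⟩
    · intro i; refine Fin.cases ?_ ?_ i <;> simp [hδ, h1]
    · intro i; refine Fin.cases ?_ ?_ i <;> simp [hzδ, h2]
    · intro i
      rw [Fin.range_cons, Ideal.span_insert, ← sup_assoc]
      exact h3 i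
    · refine le_trans ?_ (dim_drop le_sup_left (J' := G ⊔ Ideal.span {z}) ?_)
      · push_cast; gcongr
      · intro q hq hle
        exact hav q hq (hle (Ideal.mem_sup_right (Ideal.mem_span_singleton_self z)))
end AvoidSec
end Wrap4

section Wrap5
open MvPolynomial
section FinSec
lemma finite_of_gen {A B ι : Type*} [CommRing A] [CommRing B] (φ : A →+* B) (S : Finset ι) (b : ι → B)
    (h : ∀ x, ∃ a : ι → A, x = ∑ s ∈ S, φ (a s) * b s) : φ.Finite := by
  classical
  letI := φ.toAlgebra
  refine ⟨⟨S.image b, ?_⟩⟩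
  rw [eq_top_iff]
  rintro x -
  obtain ⟨a, rfl⟩ := h x
  refine Submodule.sum_mem _ fun s hs => ?_
  have : φ (a s) * b s = a s • b s := rfl
  rw [this]
  exact Submodule.smul_mem _ _ (Submodule.subset_span (by simpa using ⟨s, hs, rfl⟩))

variable {k : Type} [Field k] {n : ℕ} {w : Fin n → ℕ} {m : ℕ} {w' : Fin m → ℕ}
  {y : Fin m → MvPolynomial (Fin n) k}

lemma eta_hom (hy : ∀ i, IsWeightedHomogeneous w (y i) (w' i)) {f : MvPolynomial (Fin m) k} {j : ℕ}
    (hf : IsWeightedHomogeneous w' f j) : IsWeightedHomogeneous w (aeval y f) j := by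
  rw [aeval_def, eval₂_eq]
  apply IsWeightedHomogeneous.sum
  intro a ha
  have h1 := hf (mem_support_iff.mp ha)
  rw [← h1, ← zero_add (Finsupp.weight w' a)]
  apply IsWeightedHomogeneous.mul
  · exact isWeightedHomogeneous_C w _
  · rw [Finsupp.weight_apply, Finsupp.sum]
    apply IsWeightedHomogeneous.prod
    intro i _
    have := (hy i).pow (a i)
    exact this

lemma wc_eta (hy : ∀ i, IsWeightedHomogeneous w (y i) (w' i)) (f : MvPolynomial (Fin m) k) (j : ℕ) :
    wc w j (aeval y f) = aeval y (wc w' j f) := by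
  obtain ⟨J, hJ⟩ := fil_exists (w := w') f
  have hJ' : f ∈ Fil w' ((J + j : ℕ) : ℤ) := fil_mono (by push_cast; omega) hJ
  conv_lhs => rw [sum_wc hJ', map_sum, wc, map_sum]
  rw [Finset.sum_eq_single j]
  · exact wc_same (eta_hom hy (wc_hom _ _))
  · intro i _ hi
    exact wc_ne (eta_hom hy (wc_hom _ _)) hi.symm
  · intro h; simp at h

lemma fil_eta (hy : ∀ i, IsWeightedHomogeneous w (y i) (w' i)) {f : MvPolynomial (Fin m) k} {j : ℤ}
    (hf : f ∈ Fil w' j) : aeval y f ∈ Fil w j := by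
  apply fil_of_wc
  intro i hi
  rw [wc_eta hy, wc_zero_of_fil hi hf, map_zero]

/-- elements of filtered degree `j` which are filtered combinations of the monomials in `B` mod `J` -/
def GG (w : Fin n → ℕ) (w' : Fin m → ℕ) (y : Fin m → MvPolynomial (Fin n) k)
    (B : Finset (Fin n →₀ ℕ)) (J : Ideal (MvPolynomial (Fin n) k)) (j : ℤ) :
    Submodule k (MvPolynomial (Fin n) k) where
  carrier := {f | ∃ a : (Fin n →₀ ℕ) → MvPolynomial (Fin m) k,
    (∀ s, a s ∈ Fil w' (j - (Finsupp.weight w s : ℕ))) ∧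
    f - ∑ s ∈ B, aeval y (a s) * monomial s 1 ∈ J}
  zero_mem' := ⟨0, fun _ => Submodule.zero_mem _, by simp⟩
  add_mem' := by
    rintro f g ⟨a, ha, ha'⟩ ⟨b, hb, hb'⟩
    refine ⟨a + b, fun s => Submodule.add_mem _ (ha s) (hb s), ?_⟩
    have := J.add_mem ha' hb'
    convert this using 1
    simp only [Pi.add_apply, map_add, add_mul, Finset.sum_add_distrib]
    ring
  smul_mem' := by
    rintro c f ⟨a, ha, ha'⟩
    refine ⟨c • a, fun s => Submodule.smul_mem _ c (ha s), ?_⟩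
    have := J.mul_mem_left (C c) ha'
    convert this using 1
    rw [mul_sub, Finset.mul_sum, smul_eq_C_mul]
    congr 1
    apply Finset.sum_congr rfl
    intro s _
    rw [Pi.smul_apply, map_smul, smul_eq_C_mul]
    ring

variable {B : Finset (Fin n →₀ ℕ)} {J : Ideal (MvPolynomial (Fin n) k)}

lemma GG_mono {i j : ℤ} (h : i ≤ j) : GG w w' y B J i ≤ GG w w' y B J j := by
  rintro f ⟨a, ha, ha'⟩
  exact ⟨a, fun s => fil_mono (by omega) (ha s), ha'⟩

lemma GG_add {j : ℤ} {f g : MvPolynomial (Fin n) k} (hf : f ∈ GG w w' y B J j) (h : g - f ∈ J) :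
    g ∈ GG w w' y B J j := by
  obtain ⟨a, ha, ha'⟩ := hf
  refine ⟨a, ha, ?_⟩
  have := J.add_mem h ha'
  convert this using 1
  ring

lemma GG_y {j : ℤ} {f : MvPolynomial (Fin n) k} (hf : f ∈ GG w w' y B J j) (i : Fin m) :
    f * y i ∈ GG w w' y B J (j + w' i) := by
  obtain ⟨a, ha, ha'⟩ := hf
  refine ⟨fun s => a s * X i, fun s => ?_, ?_⟩
  · refine fil_mono ?_ (fil_mul (ha s) (fil_of_hom (isWeightedHomogeneous_X k w' i)))
    omega
  · have := J.mul_mem_right (y i) ha'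
    convert this using 1
    rw [sub_mul, Finset.sum_mul]
    congr 1
    apply Finset.sum_congr rfl
    intro s _
    rw [map_mul, aeval_X]
    ring

lemma fil_le_GG (hw' : ∀ i, 0 < w' i) (hy : ∀ i, IsWeightedHomogeneous w (y i) (w' i))
    {𝔤 : Ideal (MvPolynomial (Fin n) k)} (hGJ : 𝔤 ≤ LowI w J 1)
    (hB : ∀ s, s ∉ B → monomial s 1 ∈ 𝔤 ⊔ Ideal.span (Set.range y)) (j : ℤ) :
    Fil w j ≤ GG w w' y B J j := by
  classical
  suffices H : ∀ N : ℕ, ∀ j : ℤ, j < N → Fil w j ≤ GG w w' y B J j by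
    exact H (j.toNat + 1) j (by push_cast; omega)
  intro N
  induction N with
  | zero =>
    intro j hj f hf
    rw [fil_neg (by simpa using hj) hf]
    exact Submodule.zero_mem _
  | succ N ih =>
    intro j hj f hf
    rw [f.as_sum]
    refine Submodule.sum_mem _ fun a ha => ?_
    have hwa := hf a (mem_support_iff.mp ha)
    have : monomial a (coeff a f) = (coeff a f) • monomial a (1 : k) := by
      rw [smul_monomial, smul_eq_mul, mul_one]
    rw [this]
    refine Submodule.smul_mem _ _ (GG_mono hwa ?_)
    by_cases haB : a ∈ B
    · refine ⟨Pi.single a 1, fun s => ?_, ?_⟩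
      · by_cases hs : s = a
        · subst hs; simpa using fil_one
        · simp [Pi.single_apply, hs]
      · rw [Finset.sum_eq_single a]
        · simp
        · intro b _ hb; simp [Pi.single_apply, hb]
        · intro h; exact absurd haB h
    · have h1 := hB a haB
      obtain ⟨g, hg, h, hh, hgh⟩ := Submodule.mem_sup.mp h1
      obtain ⟨c, rfl⟩ := (Submodule.mem_span_range_iff_exists_fun _).mp hh
      set d := Finsupp.weight w a with hd
      have h2 : wc w d (monomial a (1 : k)) = monomial a 1 :=
        wc_same (isWeightedHomogeneous_monomial w a 1 hd.symm)
      rw [← h2, ← hgh, wc, map_add, map_sum]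
      refine Submodule.add_mem _ ?_ (Submodule.sum_mem _ fun i _ => ?_)
      · obtain ⟨g', hg', hgJ⟩ := hGJ hg d
        exact GG_add (GG_mono (by omega) (ih (d - 1) (by omega) (by exact_mod_cast hg'))) hgJ
      · rw [smul_eq_mul, mul_comm]
        by_cases hdi : d < w' i
        · have := wc_mul_hom' (w := w) (hy i) (c i) hdi
          rw [wc] at this
          rw [this]
          exact Submodule.zero_mem _
        · push Not at hdi
          have := wc_mul_hom (w := w) (i := d - w' i) (hy i) (c i)
          rw [Nat.add_sub_cancel' hdi, wc] at this
          rw [this, mul_comm]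
          have hpos := hw' i
          have h5 := GG_y (ih ((d - w' i : ℕ) : ℤ) (by omega) (fil_of_hom (wc_hom (d - w' i) (c i)))) i
          refine GG_mono ?_ h5
          omega

lemma eta_finite (hw' : ∀ i, 0 < w' i) (hy : ∀ i, IsWeightedHomogeneous w (y i) (w' i))
    {𝔤 : Ideal (MvPolynomial (Fin n) k)} (hGJ : 𝔤 ≤ LowI w J 1)
    (hB : ∀ s, s ∉ B → monomial s 1 ∈ 𝔤 ⊔ Ideal.span (Set.range y)) :
    ((Ideal.Quotient.mk J).comp (aeval y : _ →ₐ[k] MvPolynomial (Fin n) k).toRingHom).Finite := by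
  classical
  refine finite_of_gen _ B (fun s => Ideal.Quotient.mk J (monomial s 1)) fun x => ?_
  obtain ⟨f, rfl⟩ := Ideal.Quotient.mk_surjective x
  obtain ⟨j, hj⟩ := fil_exists (w := w) f
  obtain ⟨a, ha, ha'⟩ := fil_le_GG hw' hy hGJ hB j hj
  rw [← Ideal.Quotient.eq] at ha'
  refine ⟨a, ?_⟩
  rw [ha', map_sum]
  refine Finset.sum_congr rfl fun s hs => ?_
  rw [map_mul]
  rfl

lemma le_lowI_self {𝔤 : Ideal (MvPolynomial (Fin n) k)} (hG : HI w 𝔤) : 𝔤 ≤ LowI w 𝔤 1 :=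
  fun f hf j => ⟨0, Submodule.zero_mem _, by simpa using hG f hf j⟩

lemma lowI_mono {J J' : Ideal (MvPolynomial (Fin n) k)} (h : J ≤ J') (N : ℕ) : LowI w J N ≤ LowI w J' N := by
  intro f hf j
  obtain ⟨f', h1, h2⟩ := hf j
  exact ⟨f', h1, h h2⟩

lemma exists_noether (hw : ∀ i, 0 < w i) {J : Ideal (MvPolynomial (Fin n) k)} (hJ : J ≠ ⊤) :
    ∃ (m : ℕ) (y : Fin m → MvPolynomial (Fin n) k) (w' : Fin m → ℕ) (B : Finset (Fin n →₀ ℕ)),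
      (∀ i, 0 < w' i) ∧ (∀ i, IsWeightedHomogeneous w (y i) (w' i)) ∧
      (∀ s, s ∉ B → monomial s 1 ∈ initialIdeal w J ⊔ Ideal.span (Set.range y)) ∧
      (m : WithBot ℕ∞) ≤ ringKrullDim (MvPolynomial (Fin n) k ⧸ initialIdeal w J) := by
  obtain ⟨m, y, w', h1, h2, h3, h4⟩ := exists_hsop hw _ (HI_initialIdeal (w := w) J) (initialIdeal_ne_top hJ)
  choose e he using h3
  refine ⟨m, y, w', Finset.Icc 0 (Finsupp.equivFunOnFinite.symm e), h1, h2, fun s hs => ?_, h4⟩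
  have : ∃ i, e i ≤ s i := by
    by_contra hcon
    push Not at hcon
    apply hs
    rw [Finset.mem_Icc]
    exact ⟨bot_le, fun i => by simpa using (hcon i).le⟩
  obtain ⟨i, hi⟩ := this
  have h6 : monomial s (1 : k) = monomial (s - Finsupp.single i (e i)) 1 * X i ^ e i := by
    rw [X_pow_eq_monomial, monomial_mul, mul_one, tsub_add_cancel_of_le]
    rw [Finsupp.single_le_iff]
    exact hi
  rw [h6]
  exact Ideal.mul_mem_left _ _ (he i)

lemma withBot_absurd {m : ℕ} {d e : WithBot ℕ∞} (h1 : (m : WithBot ℕ∞) ≤ d) (h2 : d ≤ e)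
    (h3 : e + 1 ≤ m) : False := by
  have : (m : WithBot ℕ∞) + 1 ≤ m := le_trans (by gcongr; exact h1.trans h2) h3
  have h4 : m + 1 ≤ m := by exact_mod_cast this
  omega

lemma ker_of_dim (φ : MvPolynomial (Fin m) k →+* MvPolynomial (Fin n) k ⧸ J) (hφ : φ.IsIntegral)
    (hm : (m : WithBot ℕ∞) ≤ ringKrullDim (MvPolynomial (Fin n) k ⧸ J)) : RingHom.ker φ = ⊥ := by
  by_contra hcon
  have h1 := dim_mv_quot_lt hcon
  have h2 : ringKrullDim (MvPolynomial (Fin n) k ⧸ J) ≤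
      ringKrullDim (MvPolynomial (Fin m) k ⧸ RingHom.ker φ) := by
    apply dim_integral_le' (RingHom.kerLift φ)
    apply RingHom.IsIntegral.tower_top (Ideal.Quotient.mk (RingHom.ker φ))
    exact hφ
  exact withBot_absurd hm h2 h1

lemma dim_initial_ge (hw : ∀ i, 0 < w i) (J : Ideal (MvPolynomial (Fin n) k)) :
    ringKrullDim (MvPolynomial (Fin n) k ⧸ J) ≤
      ringKrullDim (MvPolynomial (Fin n) k ⧸ initialIdeal w J) := by
  by_cases hJ : J = ⊤
  · have : Subsingleton (MvPolynomial (Fin n) k ⧸ J) := Ideal.Quotient.subsingleton_iff.mpr hJ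
    rw [ringKrullDim_eq_bot_of_subsingleton]
    exact bot_le
  obtain ⟨m, y, w', B, h1, h2, h3, h4⟩ := exists_noether hw hJ
  refine le_trans ?_ h4
  rw [← dim_mv (k := k)]
  exact dim_integral_le' _ (eta_finite h1 h2 (initialIdeal_le_low J) h3).to_isIntegral

lemma eta_inj_in (hw' : ∀ i, 0 < w' i) (hy : ∀ i, IsWeightedHomogeneous w (y i) (w' i))
    (hB : ∀ s, s ∉ B → monomial s 1 ∈ initialIdeal w J ⊔ Ideal.span (Set.range y))
    (hm : (m : WithBot ℕ∞) ≤ ringKrullDim (MvPolynomial (Fin n) k ⧸ initialIdeal w J))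
    {f : MvPolynomial (Fin m) k} (hf : aeval y f ∈ initialIdeal w J) : f = 0 := by
  have := ker_of_dim _ (eta_finite hw' hy (le_lowI_self (HI_initialIdeal J)) hB).to_isIntegral hm
  have h2 : f ∈ RingHom.ker ((Ideal.Quotient.mk (initialIdeal w J)).comp
      (aeval y : _ →ₐ[k] MvPolynomial (Fin n) k).toRingHom) := by
    rw [RingHom.mem_ker]
    exact Ideal.Quotient.eq_zero_iff_mem.mpr hf
  rw [this] at h2
  exact h2

lemma eta_inj (hw' : ∀ i, 0 < w' i) (hy : ∀ i, IsWeightedHomogeneous w (y i) (w' i))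
    (hB : ∀ s, s ∉ B → monomial s 1 ∈ initialIdeal w J ⊔ Ideal.span (Set.range y))
    (hm : (m : WithBot ℕ∞) ≤ ringKrullDim (MvPolynomial (Fin n) k ⧸ initialIdeal w J))
    {f : MvPolynomial (Fin m) k} (hf : aeval y f ∈ J) : f = 0 := by
  suffices H : ∀ N : ℕ, ∀ f : MvPolynomial (Fin m) k, aeval y f ∈ J → f ∈ Fil w' ((N : ℤ) - 1) → f = 0 by
    obtain ⟨j, hj⟩ := fil_exists (w := w') f
    exact H (j + 1) f hf (by simpa using hj)
  intro N
  induction N with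
  | zero => intro f _ h; exact fil_neg (by simp) h
  | succ N ih =>
    intro f hf h
    have h' : f ∈ Fil w' N := by simpa using h
    have h1 := wc_mem_initialIdeal hf (fil_eta hy h')
    rw [wc_eta hy] at h1
    have h2 := eta_inj_in hw' hy hB hm h1
    apply ih f hf
    have h3 := fil_sub_wc h'
    rwa [h2, sub_zero] at h3
end FinSec
end Wrap5

section Wrap6
section KrullSec

lemma krull_loc {R : Type*} [CommRing R] [IsDomain R] [IsNoetherianRing R] (q : Ideal R) [q.IsPrime]
    {T s : R} (hT : T ∈ q) (hs : s ≠ 0) : ∃ N : ℕ, ∀ u, u ∉ q → ∀ r, s * u ≠ T ^ N * r := by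
  let L := Localization.AtPrime q
  have hnoeth : IsNoetherianRing L := IsLocalization.isNoetherianRing q.primeCompl L inferInstance
  have hinj : Function.Injective (algebraMap R L) :=
    IsLocalization.injective L q.primeCompl_le_nonZeroDivisors
  have h0 := Ideal.iInf_pow_eq_bot_of_isLocalRing (Ideal.span {algebraMap R L T}) (by
    rw [Ne, Ideal.span_singleton_eq_top]
    intro hu
    exact (IsLocalization.AtPrime.isUnit_to_map_iff L q T).mp hu hT)
  by_contra hcon
  push Not at hcon
  apply hs
  apply hinj
  rw [map_zero, ← Ideal.mem_bot, ← h0, Submodule.mem_iInf]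
  intro N
  obtain ⟨u, hu, r, hr⟩ := hcon N
  rw [Ideal.span_singleton_pow, Ideal.mem_span_singleton]
  have hunit := (IsLocalization.AtPrime.isUnit_to_map_iff L q u).mpr hu
  rw [← hunit.dvd_mul_right, ← map_mul, hr, map_mul, map_pow]
  exact dvd_mul_right _ _

lemma krull_hom {A D : Type*} [CommRing A] [IsNoetherianRing A] [CommRing D] [IsDomain D] (Φ : A →+* D)
    (q : Ideal A) [hq : q.IsPrime] (hle : RingHom.ker Φ ≤ q) {T s : A} (hT : T ∈ q) (hs : Φ s ≠ 0) :
    ∃ N : ℕ, ∀ u, u ∉ q → ∀ r, Φ (s * u) ≠ Φ (T ^ N * r) := by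
  have hker : (RingHom.ker Φ).IsPrime := RingHom.ker_isPrime Φ
  have hQ : (q.map (Ideal.Quotient.mk (RingHom.ker Φ))).IsPrime :=
    Ideal.map_isPrime_of_surjective Ideal.Quotient.mk_surjective (by rw [Ideal.mk_ker]; exact hle)
  have hQm : ∀ F, Ideal.Quotient.mk (RingHom.ker Φ) F ∈ (q.map (Ideal.Quotient.mk (RingHom.ker Φ))) → F ∈ q := by
    intro F hF
    rw [← Ideal.mem_comap, Ideal.comap_map_of_surjective _ Ideal.Quotient.mk_surjective,
      ← RingHom.ker_eq_comap_bot, Ideal.mk_ker, sup_eq_left.mpr hle] at hF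
    exact hF
  obtain ⟨N, hN⟩ := krull_loc (q.map (Ideal.Quotient.mk (RingHom.ker Φ)))
    (T := Ideal.Quotient.mk (RingHom.ker Φ) T) (s := Ideal.Quotient.mk (RingHom.ker Φ) s)
    (Ideal.mem_map_of_mem _ hT) (by
      intro h
      exact hs (Ideal.Quotient.eq_zero_iff_mem.mp h))
  refine ⟨N, fun u hu r h => hN (Ideal.Quotient.mk _ u) (fun h => hu (hQm _ h)) (Ideal.Quotient.mk _ r) ?_⟩
  rw [← map_mul, ← map_pow, ← map_mul, Ideal.Quotient.eq, RingHom.mem_ker, map_sub, h, sub_self]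

lemma krull_poly {A S : Type*} [CommRing A] [IsNoetherianRing A] [CommRing S] [IsDomain S]
    (Φ : Polynomial A →+* Polynomial S) (q : Ideal A) (hq : q.IsPrime)
    (hle : ∀ F, Φ F = 0 → F.coeff 0 ∈ q) {s : Polynomial A} (hs : Φ s ≠ 0) :
    ∃ N : ℕ, ∀ u, u ∉ q → ∀ K r, Φ (s * Polynomial.C u ^ K) ≠ Φ (Polynomial.X ^ N * r) := by
  obtain ⟨N, hN⟩ := krull_hom Φ (q.comap Polynomial.constantCoeff) (T := Polynomial.X) (s := s)
    (fun F hF => hle F hF) (by simp [Ideal.mem_comap]) hs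
  refine ⟨N, fun u hu K r => hN _ ?_ r⟩
  rw [Ideal.mem_comap, map_pow]
  intro h
  have := hq.mem_of_pow_mem _ h
  simp at this
  exact hu this

open MvPolynomial
variable {k : Type} [Field k] {n : ℕ} {w : Fin n → ℕ}

/-- homogenizing substitution `x_i ↦ x_i T^{w_i}` -/
noncomputable def Phi0 (k : Type) [Field k] {n : ℕ} (w : Fin n → ℕ) :
    MvPolynomial (Fin n) k →ₐ[k] Polynomial (MvPolynomial (Fin n) k) :=
  aeval (fun i => Polynomial.C (X i) * Polynomial.X ^ (w i))

lemma Phi0_monomial (a : Fin n →₀ ℕ) (c : k) :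
    Phi0 k w (monomial a c) = Polynomial.C (monomial a c) * Polynomial.X ^ (Finsupp.weight w a) := by
  have h1 : (algebraMap k (Polynomial (MvPolynomial (Fin n) k))) c = Polynomial.C (C c) :=
    IsScalarTower.algebraMap_apply k (MvPolynomial (Fin n) k) _ c
  rw [Phi0, aeval_monomial, monomial_eq, Finsupp.weight_apply, Finsupp.prod, Finsupp.prod, Finsupp.sum, h1]
  simp_rw [mul_pow]
  rw [Finset.prod_mul_distrib, ← mul_assoc, map_mul, map_prod, ← Finset.prod_pow_eq_pow_sum]
  simp_rw [← pow_mul, smul_eq_mul, map_pow, mul_comm]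

lemma Phi0_coeff (f : MvPolynomial (Fin n) k) (e : ℕ) : (Phi0 k w f).coeff e = wc w e f := by
  rw [f.as_sum, map_sum, wc, map_sum, Polynomial.finsetSum_coeff]
  apply Finset.sum_congr rfl
  intro a _
  rw [Phi0_monomial, Polynomial.coeff_C_mul_X_pow]
  have h1 : IsWeightedHomogeneous w (monomial a (coeff a f)) (Finsupp.weight w a) :=
    isWeightedHomogeneous_monomial w a _ rfl
  split_ifs with h
  · rw [h]; exact (wc_same h1).symm
  · exact (wc_ne h1 h).symm

lemma Phi0_hom {f : MvPolynomial (Fin n) k} {d : ℕ} (hf : IsWeightedHomogeneous w f d) :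
    Phi0 k w f = Polynomial.C f * Polynomial.X ^ d := by
  ext1 e
  rw [Phi0_coeff, Polynomial.coeff_C_mul_X_pow]
  split_ifs with h
  · rw [h]; exact wc_same hf
  · exact wc_ne hf h

noncomputable def Psi (k : Type) [Field k] {n : ℕ} (w : Fin n → ℕ) :
    Polynomial (MvPolynomial (Fin n) k) →+* Polynomial (MvPolynomial (Fin n) k) :=
  Polynomial.eval₂RingHom (Phi0 k w).toRingHom Polynomial.X

lemma Psi_C (f : MvPolynomial (Fin n) k) : Psi k w (Polynomial.C f) = Phi0 k w f := by
  simp [Psi]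

lemma Psi_X : Psi k w Polynomial.X = Polynomial.X := by
  simp [Psi]

lemma Psi_coeff_fil (F : Polynomial (MvPolynomial (Fin n) k)) (e : ℕ) :
    (Psi k w F).coeff e ∈ Fil w e := by
  induction F using Polynomial.induction_on' with
  | add F G hF hG =>
    rw [map_add, Polynomial.coeff_add]
    exact Submodule.add_mem _ hF hG
  | monomial i f =>
    rw [← Polynomial.C_mul_X_pow_eq_monomial, map_mul, map_pow, Psi_C, Psi_X, Polynomial.coeff_mul_X_pow']
    split_ifs with h
    · rw [Phi0_coeff]
      exact fil_mono (by omega) (fil_of_hom (wc_hom _ _))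
    · exact Submodule.zero_mem _

lemma Psi_wc (F : Polynomial (MvPolynomial (Fin n) k)) (e : ℕ) :
    wc w e ((Psi k w F).coeff e) = wc w e (F.coeff 0) := by
  have h : (Psi k w F).coeff e - wc w e (F.coeff 0) ∈ Fil w ((e : ℤ) - 1) := by
    have e1 := congrArg (Psi k w) (Polynomial.divX_mul_X_add F)
    rw [← e1, map_add, map_mul, Psi_C, Psi_X, Polynomial.coeff_add, Phi0_coeff, add_sub_cancel_right]
    cases e with
    | zero => simp
    | succ e =>
      rw [Polynomial.coeff_mul_X]
      refine fil_mono ?_ (Psi_coeff_fil _ e)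
      push_cast; omega
  have h2 := wc_zero_of_fil (i := e) (by omega) h
  rw [wc, map_sub, sub_eq_zero] at h2
  rw [wc, h2]
  exact wc_same (wc_hom _ _)

lemma exists_homogenize {f : MvPolynomial (Fin n) k} {j : ℕ} (hf : f ∈ Fil w j) :
    ∃ F, Psi k w F = Polynomial.C f * Polynomial.X ^ j := by
  refine ⟨∑ d ∈ Finset.range (j + 1), Polynomial.C (wc w d f) * Polynomial.X ^ (j - d), ?_⟩
  conv_rhs => rw [sum_wc hf]
  rw [map_sum, map_sum, Finset.sum_mul]
  apply Finset.sum_congr rfl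
  intro d hd
  rw [map_mul, map_pow, Psi_C, Psi_X, Phi0_hom (wc_hom d f), mul_assoc, ← pow_add]
  congr 2
  simp at hd; omega

lemma krull_fil {p q : Ideal (MvPolynomial (Fin n) k)} (hp : p.IsPrime) (hq : q.IsPrime)
    (hpq : initialIdeal w p ≤ q) {z s : MvPolynomial (Fin n) k} {δ : ℕ}
    (hz : IsWeightedHomogeneous w z δ) (hzq : z ∉ q) (hs : s ∉ p) :
    ∃ N : ℕ, ∀ K : ℕ, ¬ ∃ f ∈ Fil w ((K * δ : ℕ) - (N : ℤ)), s * z ^ K - f ∈ p := by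
  let Φ : Polynomial (MvPolynomial (Fin n) k) →+* Polynomial (MvPolynomial (Fin n) k ⧸ p) :=
    (Polynomial.mapRingHom (Ideal.Quotient.mk p)).comp (Psi k w)
  have hle : ∀ F, Φ F = 0 → F.coeff 0 ∈ q := by
    intro F hF
    apply hpq
    obtain ⟨D, hD⟩ := fil_exists (w := w) (F.coeff 0)
    rw [sum_wc hD]
    refine Ideal.sum_mem _ fun e _ => ?_
    rw [← Psi_wc]
    apply wc_mem_initialIdeal _ (Psi_coeff_fil _ _)
    have := congrArg (fun G => Polynomial.coeff G e) hF
    simp only [Φ, RingHom.comp_apply, Polynomial.coe_mapRingHom, Polynomial.coeff_map, Polynomial.coeff_zero] at this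
    exact Ideal.Quotient.eq_zero_iff_mem.mp this
  obtain ⟨D, hD⟩ := fil_exists (w := w) s
  obtain ⟨Sh, hSh⟩ := exists_homogenize hD
  have hΦ : ∀ F f j, Psi k w F = Polynomial.C f * Polynomial.X ^ j →
      Φ F = Polynomial.C (Ideal.Quotient.mk p f) * Polynomial.X ^ j := by
    intro F f j h
    simp [Φ, h]
  have hS0 : Φ Sh ≠ 0 := by
    rw [Ne, hΦ _ _ _ hSh]
    intro h
    have := mul_eq_zero.mp h
    rcases this with h | h
    · rw [Polynomial.C_eq_zero] at h
      exact hs (Ideal.Quotient.eq_zero_iff_mem.mp h)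
    · exact pow_ne_zero _ Polynomial.X_ne_zero h
  obtain ⟨N, hN⟩ := krull_poly Φ q hq hle hS0
  refine ⟨N, fun K => ?_⟩
  rintro ⟨f, hf, hfp⟩
  have hzΨ : Psi k w (Sh * Polynomial.C z ^ K) = Polynomial.C (s * z ^ K) * Polynomial.X ^ (D + K * δ) := by
    rw [map_mul, map_pow, Psi_C, hSh, Phi0_hom hz, mul_pow, ← pow_mul, pow_add, map_mul, map_pow,
      mul_comm δ K]
    ring
  have hfp' : Ideal.Quotient.mk p (s * z ^ K) = Ideal.Quotient.mk p f := Ideal.Quotient.eq.mpr hfp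
  by_cases hneg : ((K * δ : ℕ) : ℤ) < N
  · have hf0 : f = 0 := fil_neg (by omega) hf
    apply hN _ hzq K 0
    rw [mul_zero, map_zero, hΦ _ _ _ hzΨ, hfp', hf0]
    simp
  · push Not at hneg
    have hNle : N ≤ K * δ := by exact_mod_cast hneg
    obtain ⟨G, hG⟩ := exists_homogenize (w := w) (f := f) (j := K * δ - N)
      (by rw [Nat.cast_sub hNle]; exact hf)
    have hGΨ : Psi k w (Polynomial.X ^ N * (Polynomial.X ^ D * G)) =
        Polynomial.C f * Polynomial.X ^ (D + K * δ) := by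
      have : D + K * δ = N + (D + (K * δ - N)) := by omega
      rw [map_mul, map_mul, map_pow, map_pow, Psi_X, hG, this, pow_add, pow_add]
      ring
    apply hN _ hzq K (Polynomial.X ^ D * G)
    rw [hΦ _ _ _ hzΨ, hΦ _ _ _ hGΨ, hfp']
end KrullSec
end Wrap6

section Wrap7
open MvPolynomial
section FreeSec

lemma free_approx {A S β : Type} [CommRing A] [IsDomain A] [CommRing S] [IsDomain S] [Fintype β]
    (φ : A →+* S) (hφ : Function.Injective φ) (b : β → S)
    (hb : ∀ s, ∃ a : β → A, s = ∑ i, φ (a i) * b i) :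
    ∃ (τ : Type) (_ : Fintype τ) (e : τ → β) (σ : A) (ι : S →+ (τ → A)), σ ≠ 0 ∧
      (∀ a s i, ι (φ a * s) i = a * ι s i) ∧
      (∀ s, ∑ i, φ (ι s i) * b (e i) = φ σ * s) := by
  classical
  letI := φ.toAlgebra
  have hsm : ∀ (a : A) (s : S), a • s = φ a * s := fun a s => rfl
  obtain ⟨t, hli, hmax⟩ := exists_maximal_linearIndepOn A b
  have hall : ∀ i, ∃ a : A, a ≠ 0 ∧ a • b i ∈ Submodule.span A (b '' t) := by
    intro i
    by_cases hi : i ∈ t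
    · exact ⟨1, one_ne_zero, by rw [one_smul]; exact Submodule.subset_span ⟨i, hi, rfl⟩⟩
    · exact hmax i hi
  choose c hc0 hc using hall
  let σ := ∏ i, c i
  have hσ0 : σ ≠ 0 := Finset.prod_ne_zero_iff.mpr fun i _ => hc0 i
  have hσb : ∀ i, σ • b i ∈ Submodule.span A (b '' t) := by
    intro i
    have : σ = (∏ j ∈ Finset.univ.erase i, c j) * c i := (Finset.prod_erase_mul _ _ (Finset.mem_univ i)).symm
    rw [this, mul_smul]
    exact Submodule.smul_mem _ _ (hc i)
  have hσ : ∀ s : S, σ • s ∈ Submodule.span A (Set.range fun i : t => b i) := by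
    intro s
    have hr : Set.range (fun i : t => b i) = b '' t := by
      ext x; simp
    rw [hr]
    obtain ⟨a, rfl⟩ := hb s
    rw [Finset.smul_sum]
    refine Submodule.sum_mem _ fun i _ => ?_
    rw [← hsm, smul_comm]
    exact Submodule.smul_mem _ _ (hσb i)
  have hli' : LinearIndependent A (fun i : t => b i) := hli
  let L : S →ₗ[A] Submodule.span A (Set.range fun i : t => b i) :=
    { toFun := fun s => ⟨σ • s, hσ s⟩
      map_add' := fun x y => by ext; simp
      map_smul' := fun a x => Subtype.ext (smul_comm σ a x) }
  let ι0 : S →ₗ[A] (t →₀ A) := hli'.repr.comp L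
  let ι1 : S →ₗ[A] (t → A) := (Finsupp.linearEquivFunOnFinite A A t).toLinearMap.comp ι0
  refine ⟨t, inferInstance, Subtype.val, σ, ι1.toAddMonoidHom, hσ0, ?_, ?_⟩
  · intro a s i
    have := ι1.map_smul a s
    rw [hsm] at this
    have h2 := congrFun this i
    exact h2
  · intro s
    have h := hli'.linearCombination_repr (L s)
    rw [Finsupp.linearCombination_apply, Finsupp.sum_fintype _ _ (by simp)] at h
    exact h

end FreeSec
section CoreSec
variable {k : Type} [Field k] {m : ℕ} {w' : Fin m → ℕ}

lemma split_div {G f : MvPolynomial (Fin m) k} {L : ℤ}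
    (h : ∀ e : ℕ, L < e → G ∣ wc w' e f) : ∃ q r, f = G * q + r ∧ r ∈ Fil w' L := by
  classical
  obtain ⟨J, hJ⟩ := fil_exists (w := w') f
  have h' : ∀ e : ℕ, ∃ q, L < e → wc w' e f = G * q := by
    intro e
    by_cases he : L < e
    · obtain ⟨q, hq⟩ := h e he
      exact ⟨q, fun _ => hq⟩
    · exact ⟨0, fun h => absurd h he⟩
  choose q hq using h'
  refine ⟨∑ e ∈ (Finset.range (J + 1)).filter (fun e : ℕ => L < e), q e,
    ∑ e ∈ (Finset.range (J + 1)).filter (fun e : ℕ => ¬ L < e), wc w' e f, ?_, ?_⟩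
  · conv_lhs => rw [sum_wc hJ, ← Finset.sum_filter_add_sum_filter_not _ (fun e : ℕ => L < e)]
    congr 1
    rw [Finset.mul_sum]
    apply Finset.sum_congr rfl
    intro e he
    exact hq e (Finset.mem_filter.mp he).2
  · refine Submodule.sum_mem _ fun e he => ?_
    have := (Finset.mem_filter.mp he).2
    exact fil_mono (by omega) (fil_of_hom (wc_hom e f))

lemma dvd_aux {G H f f' : MvPolynomial (Fin m) k} {Γ Θ : ℕ} {L : ℤ}
    (hG : IsWeightedHomogeneous w' G Γ) (hH : IsWeightedHomogeneous w' H Θ) (hrel : IsRelPrime G H)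
    (h : H * f - G * f' ∈ Fil w' (Θ + L)) (e : ℕ) (he : L < e) : G ∣ wc w' e f := by
  have h1 := wc_zero_of_fil (i := Θ + e) (by push_cast; omega) h
  rw [wc, map_sub] at h1
  have h2 := wc_mul_hom (w := w') (i := e) hH f
  rw [wc] at h2
  rw [h2, sub_eq_zero] at h1
  refine hrel.dvd_of_dvd_mul_left ?_
  rw [h1]
  by_cases hΓ : Θ + e < Γ
  · have h3 := wc_mul_hom' (w := w') hG f' hΓ
    rw [wc] at h3
    rw [h3]
    exact dvd_zero _
  · have h3 := wc_mul_hom (w := w') (i := Θ + e - Γ) hG f'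
    rw [Nat.add_sub_cancel' (by omega), wc] at h3
    rw [h3]
    exact dvd_mul_right _ _

lemma core_abs {S β : Type} [CommRing S] [IsDomain S] [Fintype β]
    (φ : MvPolynomial (Fin m) k →+* S) (hφ : Function.Injective φ) (FS : ℤ → AddSubgroup S)
    (hmono : ∀ i j, i ≤ j → FS i ≤ FS j) (hmul : ∀ i j x y, x ∈ FS i → y ∈ FS j → x * y ∈ FS (i + j))
    (hφF : ∀ j f, f ∈ Fil w' j → φ f ∈ FS j) (b : β → S) (d : β → ℕ)
    (hbF : ∀ i, b i ∈ FS (d i)) (hex : ∀ s, ∃ j, s ∈ FS j)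
    (hgen : ∀ j s, s ∈ FS j → ∃ a : β → MvPolynomial (Fin m) k, (∀ i, a i ∈ Fil w' (j - d i)) ∧
      s = ∑ i, φ (a i) * b i) :
    ∃ (σ : MvPolynomial (Fin m) k) (C : ℕ), σ ≠ 0 ∧ ∀ (N : ℕ), 5 * C < N → ∀ (G H) (Γ Θ : ℕ),
      IsWeightedHomogeneous w' G Γ → IsWeightedHomogeneous w' H Θ → G ≠ 0 → IsRelPrime G H →
      ∀ u v u' v', u ∈ FS Γ → u' ∈ FS Θ → φ G = u + v → φ H = u' + v' →
      u * v ∈ FS (Γ + Γ - N) → v' * u ∈ FS (Θ + Γ - N) → v * u' ∈ FS (Θ + Γ - N) →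
      ∀ ζ ζ' κ κ', ζ ∈ FS κ → ζ' ∈ FS κ' → ζ * v ∈ FS (κ + Γ - N) → ζ' * u ∈ FS (κ' + Γ - N) →
      (φ σ * (φ σ * ζ) ∈ FS (κ - N + 4 * C) ∨ φ σ * (φ σ * ζ') ∈ FS (κ' - N + 4 * C)) := by
  classical
  obtain ⟨τ, _, e, σ, ι, hσ0, hι, hκ⟩ := free_approx φ hφ b (fun s => by
    obtain ⟨j, hj⟩ := hex s
    obtain ⟨a, -, ha⟩ := hgen j s hj
    exact ⟨a, ha⟩)
  -- constants
  have hc1 : ∀ (i : β) (t : τ), ∃ j : ℕ, ι (b i) t ∈ Fil w' j := fun i t => fil_exists _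
  choose c1 hc1 using hc1
  obtain ⟨c2, hc2⟩ := fil_exists (w := w') σ
  let C : ℕ := (∑ i, ∑ t, c1 i t) + c2 + ∑ i, d i
  have hC1 : ∀ i t, c1 i t ≤ C := by
    intro i t
    have h1 : c1 i t ≤ ∑ t, c1 i t := Finset.single_le_sum (f := fun t => c1 i t) (fun _ _ => Nat.zero_le _) (Finset.mem_univ t)
    have h2 : ∑ t, c1 i t ≤ ∑ i, ∑ t, c1 i t :=
      Finset.single_le_sum (f := fun i => ∑ t, c1 i t) (fun _ _ => Nat.zero_le _) (Finset.mem_univ i)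
    simp only [C]; omega
  have hC2 : c2 ≤ C := by simp only [C]; omega
  have hC3 : ∀ i, d i ≤ C := by
    intro i
    have h2 : d i ≤ ∑ i, d i :=
      Finset.single_le_sum (f := fun i => d i) (fun _ _ => Nat.zero_le _) (Finset.mem_univ i)
    simp only [C]; omega
  clear_value C
  have hσF : φ σ ∈ FS C := hφF _ _ (fil_mono (by exact_mod_cast hC2) hc2)
  have hιF : ∀ j s, s ∈ FS j → ∀ t, ι s t ∈ Fil w' (j + C) := by
    intro j s hs t
    obtain ⟨a, ha, rfl⟩ := hgen j s hs
    rw [map_sum, Finset.sum_apply]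
    refine Submodule.sum_mem _ fun i _ => ?_
    rw [hι]
    refine fil_mono ?_ (fil_mul (ha i) (hc1 i t))
    have := hC1 i t
    omega
  have hκF : ∀ j (a : τ → MvPolynomial (Fin m) k), (∀ t, a t ∈ Fil w' j) →
      ∑ t, φ (a t) * b (e t) ∈ FS (j + C) := by
    intro j a ha
    refine AddSubgroup.sum_mem _ fun t _ => ?_
    refine hmono _ _ ?_ (hmul _ _ _ _ (hφF _ _ (ha t)) (hbF (e t)))
    have := hC3 (e t)
    omega
  have hD : ∀ {g : MvPolynomial (Fin m) k} {D : ℕ} {j : ℤ} {s : S}, IsWeightedHomogeneous w' g D → g ≠ 0 →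
      φ g * s ∈ FS (D + j) → ∀ t, ι s t ∈ Fil w' (j + C) := by
    intro g D j s hg hg0 hs t
    have := hιF _ _ hs t
    rw [hι] at this
    exact fil_div hg hg0 (by rwa [← add_assoc])
  have hφσ : φ σ ≠ 0 := by
    intro h; exact hσ0 (hφ (by rw [h, map_zero]))
  refine ⟨σ, C, hσ0, ?_⟩
  intro N hN G H Γ Θ hG hH hG0 hrel u v u' v' hu hu' hGuv hHuv huv hvu hvu' ζ ζ' κ κ' hζ hζ' hζv hζu
  have hGF : φ G ∈ FS Γ := hφF _ _ (fil_of_hom hG)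
  -- splitting
  have hsplit : ∀ t, ∃ q r, ι u t = G * q + r ∧ r ∈ Fil w' ((Γ : ℤ) - N + C) := by
    intro t
    apply split_div
    intro e he
    refine dvd_aux (f' := ι u' t) hG hH hrel ?_ e he
    rw [← hι, ← hι, ← Pi.sub_apply, ← map_sub]
    have h1 : φ H * u - φ G * u' = v' * u - v * u' := by rw [hGuv, hHuv]; ring
    rw [h1]
    have := hιF _ _ (AddSubgroup.sub_mem _ hvu hvu') t
    refine fil_mono ?_ this
    omega
  choose q r hqr hr using hsplit
  have hq : ∀ t, q t ∈ Fil w' (C : ℤ) := by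
    intro t
    apply fil_div hG hG0
    have : G * q t = ι u t - r t := by rw [hqr]; ring
    rw [this]
    refine Submodule.sub_mem _ (hιF _ _ hu t) (fil_mono ?_ (hr t))
    omega
  set x := ∑ t, φ (q t) * b (e t) with hx
  set ρ := ∑ t, φ (r t) * b (e t) with hρ
  have hxF : x ∈ FS (C + C) := hκF _ _ hq
  have hρF : ρ ∈ FS ((Γ : ℤ) - N + C + C) := hκF _ _ hr
  have hσu : φ σ * u = φ G * x + ρ := by
    rw [← hκ u, hx, hρ, Finset.mul_sum, ← Finset.sum_add_distrib]
    apply Finset.sum_congr rfl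
    intro t _
    rw [hqr, map_add, map_mul]
    ring
  have hv : v = φ G - u := by rw [hGuv]; ring
  have hquad : φ (G * G) * (x * (x - φ σ)) =
      (φ G * (φ σ * ρ) - φ G * (x * ρ) - φ G * (x * ρ) - ρ * ρ) - φ σ * (φ σ * (u * v)) := by
    have h1 : φ σ * (φ σ * (u * v)) = (φ σ * u) * (φ G * φ σ - φ σ * u) := by rw [hv]; ring
    rw [h1, hσu, map_mul]
    ring
  have hqF : φ (G * G) * (x * (x - φ σ)) ∈ FS (((Γ + Γ : ℕ) : ℤ) + (4 * C - N)) := by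
    rw [hquad]
    have e1 := hmul _ _ _ _ hGF (hmul _ _ _ _ hσF hρF)
    have e2 := hmul _ _ _ _ hGF (hmul _ _ _ _ hxF hρF)
    have e3 := hmul _ _ _ _ hρF hρF
    have e4 := hmul _ _ _ _ hσF (hmul _ _ _ _ hσF huv)
    refine AddSubgroup.sub_mem _ (AddSubgroup.sub_mem _ (AddSubgroup.sub_mem _ (AddSubgroup.sub_mem _
      (hmono _ _ ?_ e1) (hmono _ _ ?_ e2)) (hmono _ _ ?_ e2)) (hmono _ _ ?_ e3)) (hmono _ _ ?_ e4)
    all_goals push_cast; omega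
  have hx0 : x * (x - φ σ) = 0 := by
    have h1 := hD (hG.mul hG) (mul_ne_zero hG0 hG0) hqF
    have h2 : ∀ t, ι (x * (x - φ σ)) t = 0 := fun t => fil_neg (by omega) (h1 t)
    have h3 := hκ (x * (x - φ σ))
    simp only [h2, map_zero, zero_mul, Finset.sum_const_zero] at h3
    exact (mul_eq_zero.mp h3.symm).resolve_left hφσ
  have hfin : ∀ (ξ : S) (j : ℤ), φ G * (φ σ * ξ) ∈ FS (Γ + (j - N + 2 * C)) →
      φ σ * (φ σ * ξ) ∈ FS (j - N + 4 * C) := by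
    intro ξ j h
    have h1 := hD hG hG0 h
    rw [← hκ]
    refine hmono _ _ ?_ (hκF _ _ h1)
    omega
  rcases mul_eq_zero.mp hx0 with h0 | h0
  · left
    apply hfin
    have : φ G * (φ σ * ζ) = ρ * ζ + φ σ * (ζ * v) := by
      have : ρ = φ σ * u := by rw [hσu, h0]; ring
      rw [this, hGuv]; ring
    rw [this]
    refine AddSubgroup.add_mem _ (hmono _ _ ?_ (hmul _ _ _ _ hρF hζ)) (hmono _ _ ?_ (hmul _ _ _ _ hσF hζv))
    all_goals omega
  · right
    apply hfin
    have : φ G * (φ σ * ζ') = φ σ * (ζ' * u) - ρ * ζ' := by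
      have h1 : x = φ σ := sub_eq_zero.mp h0
      have : ρ = φ σ * u - φ G * φ σ := by rw [hσu, h1]; ring
      rw [this]; ring
    rw [this]
    refine AddSubgroup.sub_mem _ (hmono _ _ ?_ (hmul _ _ _ _ hσF hζu)) (hmono _ _ ?_ (hmul _ _ _ _ hρF hζ'))
    all_goals omega
end CoreSec
end Wrap7

section Wrap8
open MvPolynomial
section CoreP
variable {k : Type} [Field k] {n : ℕ} {w : Fin n → ℕ} {m : ℕ} {w' : Fin m → ℕ}
  {y : Fin m → MvPolynomial (Fin n) k} {B : Finset (Fin n →₀ ℕ)}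
  {p b c : Ideal (MvPolynomial (Fin n) k)}

lemma drop_aux {M N : ℕ} (hM : (b * c) ^ M ≤ initialIdeal w p)
    {x x' : MvPolynomial (Fin n) k} (hx : x ∈ b ^ (M * N)) (hx' : x' ∈ c ^ (M * N)) {i j : ℕ}
    (hi : IsWeightedHomogeneous w x i) (hj : IsWeightedHomogeneous w x' j) :
    ∃ f ∈ Fil w ((i : ℤ) + j - N), x * x' - f ∈ p := by
  have h1 : x * x' ∈ (b * c) ^ (M * N) := by
    rw [mul_pow]; exact Ideal.mul_mem_mul hx hx'
  rw [pow_mul] at h1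
  have h2 : x * x' ∈ LowI w p N :=
    lowI_pow N (Ideal.pow_right_mono (hM.trans (initialIdeal_le_low p)) N h1)
  obtain ⟨f, hf, hf'⟩ := h2 (i + j)
  rw [wc_same (hi.mul hj)] at hf'
  exact ⟨f, by simpa using hf, hf'⟩

lemma split_aux (hb : HI w b) (hc : HI w c) (hy : ∀ i, IsWeightedHomogeneous w (y i) (w' i))
    {g : MvPolynomial (Fin m) k} {γ : ℕ} (hg : IsWeightedHomogeneous w' g γ)
    (hgm : aeval y g ∈ b ⊔ c) (K : ℕ) :
    ∃ u v, u ∈ b ^ K ∧ v ∈ c ^ K ∧ IsWeightedHomogeneous w u ((K + K) * γ) ∧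
      IsWeightedHomogeneous w v ((K + K) * γ) ∧ aeval y (g ^ (K + K)) = u + v := by
  have h1 : aeval y (g ^ (K + K)) ∈ b ^ K ⊔ c ^ K := by
    rw [map_pow]
    exact Ideal.sup_pow_add_le_pow_sup_pow (Ideal.pow_mem_pow hgm _)
  obtain ⟨u, hu, v, hv, huv⟩ := Submodule.mem_sup.mp h1
  refine ⟨wc w ((K + K) * γ) u, wc w ((K + K) * γ) v, hb.pow K u hu _, hc.pow K v hv _, wc_hom _ _,
    wc_hom _ _, ?_⟩
  have h2 : IsWeightedHomogeneous w (aeval y (g ^ (K + K))) ((K + K) * γ) :=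
    eta_hom hy (by simpa using hg.pow (K + K))
  have := wc_same h2
  rw [← this, ← huv, wc, map_add]

lemma core_contra {S : Type} [CommRing S] [IsDomain S] (π : MvPolynomial (Fin n) k →+* S)
    (hπs : Function.Surjective π) (hπ : ∀ f, π f = 0 ↔ f ∈ p) (hp : p.IsPrime)
    (hw' : ∀ i, 0 < w' i) (hy : ∀ i, IsWeightedHomogeneous w (y i) (w' i))
    (hB : ∀ s, s ∉ B → monomial s 1 ∈ initialIdeal w p ⊔ Ideal.span (Set.range y))
    (hinj : ∀ f : MvPolynomial (Fin m) k, aeval y f ∈ p → f = 0)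
    (hb : HI w b) (hc : HI w c) {M : ℕ} (hM : (b * c) ^ M ≤ initialIdeal w p)
    {q q' : Ideal (MvPolynomial (Fin n) k)} (hq : q.IsPrime) (hq' : q'.IsPrime)
    (hpq : initialIdeal w p ≤ q) (hpq' : initialIdeal w p ≤ q')
    {z z' : MvPolynomial (Fin n) k} {δ δ' : ℕ} (hz : IsWeightedHomogeneous w z δ)
    (hz' : IsWeightedHomogeneous w z' δ') (hzb : z ∈ b) (hzc : z' ∈ c) (hzq : z ∉ q) (hzq' : z' ∉ q')
    {g h : MvPolynomial (Fin m) k} {γ θ : ℕ} (hg : IsWeightedHomogeneous w' g γ)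
    (hh : IsWeightedHomogeneous w' h θ) (hg0 : g ≠ 0) (hgh : IsRelPrime g h)
    (hgm : aeval y g ∈ b ⊔ c) (hhm : aeval y h ∈ b ⊔ c) : False := by
  classical
  let FS : ℤ → AddSubgroup S := fun j => (Fil w j).toAddSubgroup.map π.toAddMonoidHom
  have hFS : ∀ j s, s ∈ FS j ↔ ∃ f ∈ Fil w j, π f = s := fun j s => Iff.rfl
  let φ : MvPolynomial (Fin m) k →+* S := π.comp (aeval y : _ →ₐ[k] MvPolynomial (Fin n) k).toRingHom
  have hφ : ∀ f, φ f = π (aeval y f) := fun f => rfl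
  have hsub : ∀ f g, f - g ∈ p → π f = π g := by
    intro f g h
    have := (hπ _).2 h
    rwa [map_sub, sub_eq_zero] at this
  have hsub' : ∀ f g, π f = π g → f - g ∈ p := by
    intro f g h
    apply (hπ _).1
    rw [map_sub, h, sub_self]
  have hφi : Function.Injective φ := by
    rw [injective_iff_map_eq_zero]
    intro f hf
    exact hinj f ((hπ _).1 hf)
  obtain ⟨σ, C, hσ0, H⟩ := core_abs (w' := w') (β := B) φ hφi FS
    (by
      rintro i j hij s ⟨f, hf, rfl⟩
      exact ⟨f, fil_mono hij hf, rfl⟩)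
    (by
      rintro i j _ _ ⟨f, hf, rfl⟩ ⟨f', hf', rfl⟩
      exact ⟨f * f', fil_mul hf hf', map_mul π _ _⟩)
    (fun j f hf => ⟨aeval y f, fil_eta hy hf, rfl⟩)
    (fun s => π (monomial s.1 1)) (fun s => Finsupp.weight w s.1)
    (fun s => ⟨monomial s.1 1, fil_of_hom (isWeightedHomogeneous_monomial w _ _ rfl), rfl⟩)
    (fun s => by
      obtain ⟨f, rfl⟩ := hπs s
      obtain ⟨j, hj⟩ := fil_exists (w := w) f
      exact ⟨j, f, hj, rfl⟩)
    (by
      rintro j s ⟨f, hf, rfl⟩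
      obtain ⟨a, ha, ha'⟩ := fil_le_GG hw' hy (initialIdeal_le_low p) hB j hf
      refine ⟨fun s => a s.1, fun s => ha s.1, ?_⟩
      have h1 := hsub _ _ ha'
      rw [map_sum] at h1
      refine h1.trans ?_
      rw [← Finset.sum_coe_sort]
      exact Finset.sum_congr rfl fun s _ => map_mul π _ _)
  have hFm : ∀ j f, f ∈ Fil w j → π f ∈ FS j := fun j f hf => (hFS j _).2 ⟨f, hf, rfl⟩
  clear_value FS φ
  have hs : aeval y (σ * σ) ∉ p := fun h => by
    have := hinj _ h
    exact hσ0 (mul_self_eq_zero.mp this)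
  obtain ⟨N1, hN1⟩ := krull_fil hp hq hpq hz hzq hs
  obtain ⟨N2, hN2⟩ := krull_fil hp hq' hpq' hz' hzq' hs
  let N := 5 * C + 1 + N1 + N2
  have hN : N = 5 * C + 1 + N1 + N2 := rfl
  clear_value N
  obtain ⟨K, hK⟩ : ∃ K, K = M * N := ⟨_, rfl⟩
  obtain ⟨u, v, hu, hv, huh, hvh, huv⟩ := split_aux hb hc hy hg hgm K
  obtain ⟨u', v', hu', hv', huh', hvh', huv'⟩ := split_aux hb hc hy hh hhm K
  have hzK : IsWeightedHomogeneous w (z ^ K) (K * δ) := by simpa using hz.pow K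
  have hzK' : IsWeightedHomogeneous w (z' ^ K) (K * δ') := by simpa using hz'.pow K
  have hd : ∀ x x' : MvPolynomial (Fin n) k, x ∈ b ^ K → x' ∈ c ^ K → ∀ i j : ℕ,
      IsWeightedHomogeneous w x i → IsWeightedHomogeneous w x' j →
      π x * π x' ∈ FS ((i : ℤ) + j - N) := by
    intro x x' hx hx' i j hi hj
    rw [hK] at hx hx'
    obtain ⟨f, hf, hf'⟩ := drop_aux hM hx hx' hi hj
    rw [← map_mul]
    rw [hsub _ _ hf']; exact hFm _ _ hf
  have hd' : ∀ x x' : MvPolynomial (Fin n) k, x ∈ b ^ K → x' ∈ c ^ K → ∀ i j : ℕ,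
      IsWeightedHomogeneous w x i → IsWeightedHomogeneous w x' j →
      π x' * π x ∈ FS ((j : ℤ) + i - N) := by
    intro x x' hx hx' i j hi hj
    rw [mul_comm (π x'), add_comm (j : ℤ)]
    exact hd x x' hx hx' i j hi hj
  have hf : ∀ x : MvPolynomial (Fin n) k, ∀ i : ℕ, IsWeightedHomogeneous w x i → π x ∈ FS i :=
    fun x i hi => hFm _ _ (fil_of_hom hi)
  have hgK : IsWeightedHomogeneous w' (g ^ (K + K)) ((K + K) * γ) := by simpa using hg.pow (K + K)
  have hhK : IsWeightedHomogeneous w' (h ^ (K + K)) ((K + K) * θ) := by simpa using hh.pow (K + K)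
  have hGH : IsRelPrime (g ^ (K + K)) (h ^ (K + K)) := hgh.pow
  have e1 : φ (g ^ (K + K)) = π u + π v := by rw [hφ, huv, map_add]
  have e2 : φ (h ^ (K + K)) = π u' + π v' := by rw [hφ, huv', map_add]
  have key := H N (by omega) (g ^ (K + K)) (h ^ (K + K)) ((K + K) * γ) ((K + K) * θ)
    hgK hhK (pow_ne_zero _ hg0)
    hGH (π u) (π v) (π u') (π v') (hf _ _ huh) (hf _ _ huh')
    e1 e2
    (hd _ _ hu hv _ _ huh hvh) (hd' _ _ hu hv' _ _ huh hvh')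
    (by rw [mul_comm (π v)]; exact hd _ _ hu' hv _ _ huh' hvh)
    (π (z ^ K)) (π (z' ^ K)) ((K * δ : ℕ) : ℤ) ((K * δ' : ℕ) : ℤ) (hf _ _ hzK) (hf _ _ hzK')
    (hd _ _ (Ideal.pow_mem_pow hzb K) hv _ _ hzK hvh)
    (hd' _ _ hu (Ideal.pow_mem_pow hzc K) _ _ huh hzK')
  have fin : ∀ (x : MvPolynomial (Fin n) k) (κ N1 : ℕ), 4 * C + N1 ≤ N →
      φ σ * (φ σ * π x) ∈ FS ((κ : ℤ) - N + 4 * C) →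
      ∃ f ∈ Fil w ((κ : ℤ) - N1), aeval y (σ * σ) * x - f ∈ p := by
    intro x κ N1 hle hx
    obtain ⟨f, hf, hfe⟩ := (hFS _ _).1 hx
    refine ⟨f, fil_mono (by push_cast [← @Nat.cast_le ℤ] at hle; linarith) hf, ?_⟩
    apply hsub'
    rw [hfe, hφ, map_mul, map_mul, map_mul, mul_assoc]
  rcases key with key | key
  · exact hN1 K (fin _ _ N1 (by omega) key)
  · exact hN2 K (fin _ _ N2 (by omega) key)
end CoreP
end Wrap8

section Wrap9
open MvPolynomial

lemma dim_ker_le {A B : Type*} [CommRing A] [CommRing B] (φ : A →+* B) (hφ : φ.IsIntegral) :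
    ringKrullDim (A ⧸ RingHom.ker φ) ≤ ringKrullDim B := by
  refine dim_le_integral' (RingHom.kerLift φ) ?_ (RingHom.kerLift_injective φ)
  exact RingHom.IsIntegral.tower_top (Ideal.Quotient.mk (RingHom.ker φ)) _ hφ

lemma dim_quot_mono {R : Type*} [CommRing R] {J J' : Ideal R} (h : J ≤ J') :
    ringKrullDim (R ⧸ J') ≤ ringKrullDim (R ⧸ J) :=
  ringKrullDim_le_of_surjective (Ideal.Quotient.factor h) (Ideal.Quotient.factor_surjective h)

lemma factor_set {A : Type*} [CommRing A] [IsDomain A] [UniqueFactorizationMonoid A] {g : A}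
    (hg : g ≠ 0) : ∃ S : Set (Ideal A), S.Finite ∧ (∀ q ∈ S, ∃ π, Prime π ∧ q = Ideal.span {π}) ∧
      ∀ h, (∀ q ∈ S, h ∉ q) → IsRelPrime g h := by
  classical
  refine ⟨(fun π => Ideal.span {π}) '' {π | π ∈ UniqueFactorizationMonoid.factors g}, ?_, ?_, ?_⟩
  · apply Set.Finite.image
    exact (UniqueFactorizationMonoid.factors g).toFinset.finite_toSet.subset (fun x hx => by simpa using hx)
  · rintro _ ⟨π, hπ, rfl⟩
    exact ⟨π, UniqueFactorizationMonoid.prime_of_factor π hπ, rfl⟩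
  · intro h H d hdg hdh
    by_contra hd
    have hd0 : d ≠ 0 := by rintro rfl; exact hg (zero_dvd_iff.mp hdg)
    obtain ⟨π, hπ, hπd⟩ := WfDvdMonoid.exists_irreducible_factor hd hd0
    obtain ⟨π', hπ', ha⟩ := UniqueFactorizationMonoid.exists_mem_factors_of_dvd hg hπ (hπd.trans hdg)
    refine H _ ⟨π', hπ', rfl⟩ (Ideal.mem_span_singleton.mpr ?_)
    exact ha.symm.dvd.trans (hπd.trans hdh)

lemma exists_pow_rad {R : Type*} [CommRing R] [IsNoetherianRing R] {J K : Ideal R} (h : J ≤ K.radical) :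
    ∃ M, J ^ M ≤ K := by
  obtain ⟨M, hM⟩ := Ideal.exists_radical_pow_le_of_fg K (IsNoetherian.noetherian _)
  exact ⟨M, (Ideal.pow_right_mono h M).trans hM⟩

section ThmC
variable {k : Type} [Field k] {n : ℕ} {w : Fin n → ℕ}

lemma thmC_aux (hw : ∀ i, 0 < w i) {p b c : Ideal (MvPolynomial (Fin n) k)} (hp : p.IsPrime)
    (hb : HI w b) (hc : HI w c) (hpb : initialIdeal w p ≤ b)
    (hbc : b * c ≤ (initialIdeal w p).radical) {q q' : Ideal (MvPolynomial (Fin n) k)}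
    (hq : q.IsPrime) (hq' : q'.IsPrime)
    (hpq : initialIdeal w p ≤ q) (hpq' : initialIdeal w p ≤ q') (hbq : ¬ b ≤ q) (hcq : ¬ c ≤ q') :
    ringKrullDim (MvPolynomial (Fin n) k ⧸ p) ≤ ringKrullDim (MvPolynomial (Fin n) k ⧸ (b ⊔ c)) + 1 := by
  obtain ⟨m, y, w', B, hw', hy, hB, hm⟩ := exists_noether hw hp.ne_top
  obtain ⟨M, hM⟩ := exists_pow_rad hbc
  have hdp : ringKrullDim (MvPolynomial (Fin n) k ⧸ p) ≤ m := by
    have := dim_integral_le' _ (eta_finite hw' hy (initialIdeal_le_low p) hB).to_isIntegral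
    rwa [dim_mv] at this
  refine hdp.trans ?_
  have hHI : HI w (b ⊔ c) := hb.sup hc
  have hint := (eta_finite hw' hy (J := b ⊔ c) (𝔤 := initialIdeal w p)
    ((hpb.trans le_sup_left).trans (le_lowI_self hHI)) hB).to_isIntegral
  have hdim := dim_ker_le _ hint
  have hk : ∀ f, f ∈ RingHom.ker ((Ideal.Quotient.mk (b ⊔ c)).comp
      (aeval y : _ →ₐ[k] MvPolynomial (Fin n) k).toRingHom) ↔ aeval y f ∈ b ⊔ c := fun f => by
    rw [RingHom.mem_ker]; exact Ideal.Quotient.eq_zero_iff_mem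
  generalize RingHom.ker ((Ideal.Quotient.mk (b ⊔ c)).comp
      (aeval y : _ →ₐ[k] MvPolynomial (Fin n) k).toRingHom) = 𝔷 at hdim hk
  have hz : HI w' 𝔷 := by
    intro f hf j
    rw [hk, ← wc_eta hy]
    exact hHI _ ((hk f).1 hf) j
  suffices H : (m : WithBot ℕ∞) ≤ ringKrullDim (MvPolynomial (Fin m) k ⧸ 𝔷) + 1 from
    H.trans (add_le_add_left hdim 1)
  by_cases hz0 : 𝔷 ≤ ⊥
  · have h0 : 𝔷 = ⊥ := le_bot_iff.mp hz0
    rw [h0, ringKrullDim_eq_of_ringEquiv (RingEquiv.quotientBot _), dim_mv]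
    exact_mod_cast Nat.le_succ m
  obtain ⟨g, hg, hg0, γ, hgh⟩ := hz.exists_notMem hz0
  have hg0' : g ≠ 0 := fun h => hg0 (by rw [h]; exact Submodule.zero_mem _)
  obtain ⟨S, hS, hSp, hSr⟩ := factor_set hg0'
  by_cases hle : ∃ q ∈ S, 𝔷 ≤ q
  · obtain ⟨q, hqS, hzq⟩ := hle
    obtain ⟨π, hπ, rfl⟩ := hSp q hqS
    exact (dim_quot_mv hπ.not_unit).trans (add_le_add_left (dim_quot_mono hzq) 1)
  push Not at hle
  exfalso
  obtain ⟨h, hh, ⟨θ, hθ⟩, hhq⟩ := hom_avoid hw' hz hS (fun q hq => ⟨by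
    obtain ⟨π, hπ, rfl⟩ := hSp q hq
    exact (Ideal.span_singleton_prime hπ.ne_zero).mpr hπ, hle q hq⟩)
  obtain ⟨z, hzb, hzq, δ, hδ⟩ := hb.exists_notMem hbq
  obtain ⟨z', hzc, hzq', δ', hδ'⟩ := hc.exists_notMem hcq
  have : IsDomain (MvPolynomial (Fin n) k ⧸ p) := (Ideal.Quotient.isDomain_iff_prime p).mpr hp
  exact core_contra (Ideal.Quotient.mk p) Ideal.Quotient.mk_surjective
    (fun f => Ideal.Quotient.eq_zero_iff_mem) hp hw' hy hB (fun f hf => eta_inj hw' hy hB hm hf)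
    hb hc hM hq hq' hpq hpq' hδ hδ' hzb hzc hzq hzq' hgh hθ hg0' (hSr h hhq)
    ((hk g).1 hg) ((hk h).1 hh)

lemma thmC (hw : ∀ i, 0 < w i) {p b c : Ideal (MvPolynomial (Fin n) k)} (hp : p.IsPrime)
    (hb : HI w b) (hc : HI w c)
    (hbc : b * c ≤ (initialIdeal w p).radical) 
    (hbq : ¬ b ≤ (initialIdeal w p).radical) (hcq : ¬ c ≤ (initialIdeal w p).radical) :
    ringKrullDim (MvPolynomial (Fin n) k ⧸ p) ≤ ringKrullDim (MvPolynomial (Fin n) k ⧸ (b ⊔ c)) + 1 := by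
  have key : ∀ b : Ideal (MvPolynomial (Fin n) k), ¬ b ≤ (initialIdeal w p).radical →
      ∃ q : Ideal (MvPolynomial (Fin n) k), q.IsPrime ∧ initialIdeal w p ≤ q ∧ ¬ b ≤ q := by
    intro b hb
    by_contra H
    push Not at H
    apply hb
    rw [Ideal.radical_eq_sInf]
    exact le_sInf fun q hq => H q hq.2 hq.1
  obtain ⟨q, hq, hpq, hbq⟩ := key b hbq
  obtain ⟨q', hq', hpq', hcq⟩ := key c hcq
  have := thmC_aux hw hp (hb.sup (HI_initialIdeal p)) hc (le_sup_right)
    (by rw [Ideal.sup_mul]; exact sup_le hbc (Ideal.mul_le_left.trans Ideal.le_radical)) hq hq' hpq hpq'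
    (fun h => hbq (le_sup_left.trans h)) hcq
  exact this.trans (add_le_add_left (dim_quot_mono (sup_le_sup_right le_sup_left c)) 1)
end ThmC
end Wrap9

section Wrap10
section TopSec
open TopologicalSpace

/-- integer version of a dimension -/
noncomputable def zd (x : WithBot ℕ∞) : ℤ :=
  sSup ({-1} ∪ {d : ℤ | ∃ n : ℕ, d = (n : ℤ) ∧ (n : WithBot ℕ∞) ≤ x})

lemma topDim_eq (T : Type*) [TopologicalSpace T] : topDim T = zd (topologicalKrullDim T) := by
  unfold topDim zd
  congr 2
  ext d
  constructor
  · rintro ⟨n, rfl, c, hc⟩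
    exact ⟨n, rfl, Order.le_krullDim_iff.mpr ⟨LTSeries.mk n c hc, rfl⟩⟩
  · rintro ⟨n, rfl, h⟩
    obtain ⟨l, hl⟩ := Order.le_krullDim_iff.mp h
    subst hl
    exact ⟨l.length, rfl, l, l.strictMono⟩

lemma zd_bot : zd ⊥ = -1 := by
  have : ({-1} ∪ {d : ℤ | ∃ n : ℕ, d = (n : ℤ) ∧ (n : WithBot ℕ∞) ≤ ⊥}) = {-1} := by
    ext d
    simp only [Set.mem_union, Set.mem_singleton_iff, Set.mem_setOf_eq]
    constructor
    · rintro (h | ⟨n, -, h⟩)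
      · exact h
      · exact absurd (le_bot_iff.mp h) (WithBot.coe_ne_bot)
    · exact Or.inl
  rw [zd, this, csSup_singleton]

lemma zd_nat (m : ℕ) : zd (m : WithBot ℕ∞) = m := by
  apply le_antisymm
  · refine csSup_le (s := {-1} ∪ {d : ℤ | ∃ n : ℕ, d = (n : ℤ) ∧ (n : WithBot ℕ∞) ≤ m}) ⟨-1, Or.inl rfl⟩ ?_
    rintro d (rfl | ⟨n, rfl, h⟩)
    · omega
    · have : n ≤ m := by exact_mod_cast h
      exact_mod_cast this
  · apply le_csSup
    · refine ⟨m, ?_⟩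
      rintro d (rfl | ⟨n, rfl, h⟩)
      · omega
      · have : n ≤ m := by exact_mod_cast h
        exact_mod_cast this
    · exact Or.inr ⟨m, rfl, le_rfl⟩

lemma dim_cases {x : WithBot ℕ∞} {N : ℕ} (h : x ≤ N) : x = ⊥ ∨ ∃ m : ℕ, x = m := by
  induction x using WithBot.recBotCoe with
  | bot => exact Or.inl rfl
  | coe x =>
    right
    have h' : x ≤ N := by exact_mod_cast h
    obtain ⟨m, rfl⟩ := ENat.ne_top_iff_exists.mp (ne_top_of_le_ne_top (ENat.natCast_ne_top N) h')
    exact ⟨m, rfl⟩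

lemma zd_mono {x y : WithBot ℕ∞} {N : ℕ} (hy : y ≤ N) (h : x ≤ y) : zd x ≤ zd y := by
  rcases dim_cases (h.trans hy) with rfl | ⟨a, rfl⟩ <;> rcases dim_cases hy with rfl | ⟨b, rfl⟩
  · exact le_rfl
  · rw [zd_bot, zd_nat]; omega
  · exact absurd (le_bot_iff.mp h) (WithBot.coe_ne_bot)
  · rw [zd_nat, zd_nat]; exact_mod_cast h

lemma zd_neg {x : WithBot ℕ∞} {N : ℕ} (hx : x ≤ N) : -1 ≤ zd x := by
  rcases dim_cases hx with rfl | ⟨a, rfl⟩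
  · rw [zd_bot]
  · rw [zd_nat]; omega

lemma zd_le_succ {x y : WithBot ℕ∞} {N : ℕ} (hy : y ≤ N) (hx : x ≤ N) (h : x ≤ y + 1) : zd x ≤ zd y + 1 := by
  rcases dim_cases hx with rfl | ⟨a, rfl⟩ <;> rcases dim_cases hy with rfl | ⟨b, rfl⟩
  · simp
  · rw [zd_bot, zd_nat]; omega
  · simp only [WithBot.bot_add] at h
    exact absurd (le_bot_iff.mp h) (WithBot.coe_ne_bot)
  · rw [zd_nat, zd_nat]; exact_mod_cast h

lemma zd_succ_le {x y : WithBot ℕ∞} {N : ℕ} (hy : y ≤ N) (h0 : 0 ≤ y) (h : x + 1 ≤ y) : zd x + 1 ≤ zd y := by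
  have hx : x ≤ N := by
    refine le_trans ?_ (h.trans hy)
    exact le_add_of_nonneg_right (by simp)
  rcases dim_cases hx with rfl | ⟨a, rfl⟩ <;> rcases dim_cases hy with rfl | ⟨b, rfl⟩
  · exact absurd (le_bot_iff.mp h0) (WithBot.coe_ne_bot)
  · rw [zd_bot, zd_nat]; omega
  · exact absurd (le_bot_iff.mp h0) (WithBot.coe_ne_bot)
  · rw [zd_nat, zd_nat]; exact_mod_cast h

variable {P A : Type} [CommRing P] [CommRing A]

lemma dim_zeroLocus (J : Ideal P) :
    topologicalKrullDim (PrimeSpectrum.zeroLocus (J : Set P)) = ringKrullDim (P ⧸ J) := by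
  rw [← PrimeSpectrum.topologicalKrullDim_eq_ringKrullDim]
  have h1 := PrimeSpectrum.isClosedEmbedding_comap_of_surjective _ (Ideal.Quotient.mk J)
    Ideal.Quotient.mk_surjective
  have h2 : Set.range (PrimeSpectrum.comap (Ideal.Quotient.mk J)) = PrimeSpectrum.zeroLocus (J : Set P) := by
    rw [range_comap_of_surjective _ _ Ideal.Quotient.mk_surjective, Ideal.mk_ker]
  rw [← h2]
  exact (IsHomeomorph.topologicalKrullDim_eq _ (h1.isEmbedding.toHomeomorph.isHomeomorph)).symm

lemma dim_bdd {N : ℕ} (hN : ringKrullDim P ≤ N) (J : Ideal P) : ringKrullDim (P ⧸ J) ≤ N :=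
  (ringKrullDim_quotient_le J).trans hN

lemma conn_bdd {N : ℕ} (hN : ringKrullDim A ≤ N) :
    BddBelow {d : ℤ | ∃ Z : Set (PrimeSpectrum A), IsClosed Z ∧ ¬ ConnectedSpace ↥(Zᶜ) ∧ d = topDim ↥Z} := by
  refine ⟨-1, ?_⟩
  rintro _ ⟨Z, -, -, rfl⟩
  rw [topDim_eq]
  refine zd_neg (N := N) ?_
  refine (topologicalKrullDim_subspace_le _ Z).trans ?_
  rwa [PrimeSpectrum.topologicalKrullDim_eq_ringKrullDim]

lemma topDim_pre_le {N : ℕ} (hN : ringKrullDim P ≤ N) (f : P →+* A) (hf : Function.Surjective f)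
    (J : Ideal P) : topDim (PrimeSpectrum.comap f ⁻¹' PrimeSpectrum.zeroLocus (J : Set P)) ≤
      zd (ringKrullDim (P ⧸ J)) := by
  rw [topDim_eq]
  refine zd_mono (dim_bdd hN J) ?_
  rw [← dim_zeroLocus]
  have h1 := (PrimeSpectrum.isClosedEmbedding_comap_of_surjective _ f hf).isInducing
  exact (h1.restrictPreimage (PrimeSpectrum.zeroLocus (J : Set P))).topologicalKrullDim_le

lemma conn_upper_univ {N : ℕ} (hN : ringKrullDim P ≤ N) (f : P →+* A) (hf : Function.Surjective f) :
    connDim (PrimeSpectrum A) ≤ zd (ringKrullDim (P ⧸ RingHom.ker f)) := by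
  refine le_trans (csInf_le (conn_bdd ((ringKrullDim_le_of_surjective f hf).trans hN)) ?_)
    (topDim_pre_le hN f hf (RingHom.ker f))
  refine ⟨_, (PrimeSpectrum.isClosed_zeroLocus _).preimage (PrimeSpectrum.continuous_comap f), ?_, rfl⟩
  rw [← isConnected_iff_connectedSpace]
  rintro ⟨⟨x, hx⟩, -⟩
  apply hx
  intro a ha
  change f a ∈ x.asIdeal
  rw [show f a = 0 from ha]
  exact Submodule.zero_mem _

lemma conn_upper {N : ℕ} (hN : ringKrullDim P ≤ N) (f : P →+* A) (hf : Function.Surjective f)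
    {J1 J2 : Ideal P} (hcov : ∀ q : Ideal P, q.IsPrime → RingHom.ker f ≤ q → J1 ≤ q ∨ J2 ≤ q)
    {q1 q2 : Ideal P} (hq1 : q1.IsPrime) (hq2 : q2.IsPrime) (h1 : RingHom.ker f ≤ q1)
    (h2 : RingHom.ker f ≤ q2) (hJ1 : ¬ J1 ≤ q1) (hJ2 : ¬ J2 ≤ q2) :
    connDim (PrimeSpectrum A) ≤ zd (ringKrullDim (P ⧸ (J1 ⊔ J2))) := by
  refine le_trans (csInf_le (conn_bdd ((ringKrullDim_le_of_surjective f hf).trans hN)) ?_)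
    (topDim_pre_le hN f hf (J1 ⊔ J2))
  have hop : ∀ J : Ideal P, IsClosed (PrimeSpectrum.comap f ⁻¹' PrimeSpectrum.zeroLocus (J : Set P)) :=
    fun J => (PrimeSpectrum.isClosed_zeroLocus _).preimage (PrimeSpectrum.continuous_comap f)
  have hmem : ∀ (J : Ideal P) (x : PrimeSpectrum A),
      x ∈ PrimeSpectrum.comap f ⁻¹' PrimeSpectrum.zeroLocus (J : Set P) ↔
        J ≤ (PrimeSpectrum.comap f x).asIdeal := fun J x => Iff.rfl
  have hker : ∀ x : PrimeSpectrum A, RingHom.ker f ≤ (PrimeSpectrum.comap f x).asIdeal := by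
    intro x a ha
    change f a ∈ x.asIdeal
    rw [show f a = 0 from ha]
    exact Submodule.zero_mem _
  have hlift : ∀ q : Ideal P, q.IsPrime → RingHom.ker f ≤ q →
      ∃ x : PrimeSpectrum A, (PrimeSpectrum.comap f x).asIdeal = q := by
    intro q hq hk
    have : (⟨q, hq⟩ : PrimeSpectrum P) ∈ Set.range (PrimeSpectrum.comap f) := by
      rw [range_comap_of_surjective _ _ hf]
      exact hk
    obtain ⟨x, hx⟩ := this
    exact ⟨x, by rw [hx]⟩
  refine ⟨_, hop _, ?_, rfl⟩
  rw [← isConnected_iff_connectedSpace]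
  rintro ⟨-, hpre⟩
  obtain ⟨x1, hx1⟩ := hlift q1 hq1 h1
  obtain ⟨x2, hx2⟩ := hlift q2 hq2 h2
  obtain ⟨x, hx, hxa, hxb⟩ := hpre _ _ (hop J1).isOpen_compl (hop J2).isOpen_compl (by
      intro x hx
      rw [Set.mem_compl_iff, hmem] at hx
      rw [Set.mem_union, Set.mem_compl_iff, Set.mem_compl_iff, hmem, hmem]
      by_contra H
      push Not at H
      exact hx (sup_le H.1 H.2))
    ⟨x1, by rw [Set.mem_compl_iff, hmem, hx1]; exact fun h => hJ1 (le_sup_left.trans h),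
      by rw [Set.mem_compl_iff, hmem, hx1]; exact hJ1⟩
    ⟨x2, by rw [Set.mem_compl_iff, hmem, hx2]; exact fun h => hJ2 (le_sup_right.trans h),
      by rw [Set.mem_compl_iff, hmem, hx2]; exact hJ2⟩
  rcases hcov _ (PrimeSpectrum.comap f x).isPrime (hker x) with h | h
  · exact hxa h
  · exact hxb h

lemma conn_lower {N : ℕ} (hN : ringKrullDim P ≤ N) (f : P →+* A) (hf : Function.Surjective f) :
    zd (ringKrullDim (P ⧸ RingHom.ker f)) ≤ connDim (PrimeSpectrum A) ∨
    ∃ J1 J2 q1 q2 : Ideal P, (∀ q : Ideal P, q.IsPrime → RingHom.ker f ≤ q → J1 ≤ q ∨ J2 ≤ q) ∧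
      q1.IsPrime ∧ q2.IsPrime ∧ RingHom.ker f ≤ q1 ∧ RingHom.ker f ≤ q2 ∧ ¬ J1 ≤ q1 ∧ ¬ J2 ≤ q2 ∧
      zd (ringKrullDim (P ⧸ (J1 ⊔ J2))) ≤ connDim (PrimeSpectrum A) := by
  have hNA : ringKrullDim A ≤ N := (ringKrullDim_le_of_surjective f hf).trans hN
  obtain ⟨Z, hZ, hZc, hd⟩ := Int.csInf_mem (s := {d : ℤ | ∃ Z : Set (PrimeSpectrum A), IsClosed Z ∧
      ¬ ConnectedSpace ↥(Zᶜ) ∧ d = topDim ↥Z}) ⟨_, Set.univ, isClosed_univ, by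
        rw [← isConnected_iff_connectedSpace]
        rintro ⟨⟨x, hx⟩, -⟩
        exact hx trivial, rfl⟩ (conn_bdd hNA)
  change connDim (PrimeSpectrum A) = _ at hd
  rw [hd, topDim_eq]
  have hbd : topologicalKrullDim Z ≤ N := by
    refine (topologicalKrullDim_subspace_le _ Z).trans ?_
    rwa [PrimeSpectrum.topologicalKrullDim_eq_ringKrullDim]
  by_cases hne : Zᶜ.Nonempty
  · right
    rw [← isConnected_iff_connectedSpace] at hZc
    have hnp : ¬ IsPreconnected Zᶜ := fun h => hZc ⟨hne, h⟩
    unfold IsPreconnected at hnp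
    push Not at hnp
    obtain ⟨U, V, hU, hV, hUV, ⟨x1, hx1, hx1U⟩, ⟨x2, hx2, hx2V⟩, hem⟩ := hnp
    obtain ⟨I1, hI1⟩ := (PrimeSpectrum.isClosed_iff_zeroLocus_ideal _).mp (hU.isClosed_compl.union hZ)
    obtain ⟨I2, hI2⟩ := (PrimeSpectrum.isClosed_iff_zeroLocus_ideal _).mp (hV.isClosed_compl.union hZ)
    have m1 : ∀ x : PrimeSpectrum A, I1 ≤ x.asIdeal ↔ x ∈ Uᶜ ∪ Z := fun x => by rw [hI1]; rfl
    have m2 : ∀ x : PrimeSpectrum A, I2 ≤ x.asIdeal ↔ x ∈ Vᶜ ∪ Z := fun x => by rw [hI2]; rfl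
    have hZI : Z = PrimeSpectrum.zeroLocus ((I1 ⊔ I2 : Ideal A) : Set A) := by
      rw [PrimeSpectrum.zeroLocus_sup, ← hI1, ← hI2]
      ext x
      have := @hUV x
      simp only [Set.mem_compl_iff, Set.mem_union, Set.mem_inter_iff] at *
      tauto
    have hcm : ∀ (I : Ideal A) (x : PrimeSpectrum A), I.comap f ≤ x.asIdeal.comap f ↔ I ≤ x.asIdeal :=
      fun I x => Ideal.comap_le_comap_iff_of_surjective f hf _ _
    have hlift : ∀ q : Ideal P, q.IsPrime → RingHom.ker f ≤ q →
        ∃ x : PrimeSpectrum A, x.asIdeal.comap f = q := by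
      intro q hq hk
      have : (⟨q, hq⟩ : PrimeSpectrum P) ∈ Set.range (PrimeSpectrum.comap f) := by
        rw [range_comap_of_surjective _ _ hf]
        exact hk
      obtain ⟨x, hx⟩ := this
      exact ⟨x, congrArg PrimeSpectrum.asIdeal hx⟩
    have hker : ∀ I : Ideal A, RingHom.ker f ≤ I.comap f := by
      intro I a ha
      rw [Ideal.mem_comap, show f a = 0 from ha]
      exact Submodule.zero_mem _
    refine ⟨I1.comap f, I2.comap f, x1.asIdeal.comap f, x2.asIdeal.comap f, ?_, inferInstance,
      inferInstance, hker _, hker _, ?_, ?_, ?_⟩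
    · intro q hq hk
      obtain ⟨x, rfl⟩ := hlift q hq hk
      rw [hcm, hcm, m1, m2]
      by_contra H
      push Not at H
      simp only [Set.mem_union, Set.mem_compl_iff, not_or, not_not] at H
      have : x ∈ Zᶜ ∩ (U ∩ V) := ⟨H.1.2, H.1.1, H.2.1⟩
      rw [hem] at this
      exact this
    · rw [hcm, m1]
      rintro (h | h)
      · exact h hx1U
      · exact hx1 h
    · rw [hcm, m2]
      rintro (h | h)
      · exact h hx2V
      · exact hx2 h
    · refine zd_mono hbd ?_
      rw [hZI, dim_zeroLocus]
      let g : P →+* A ⧸ (I1 ⊔ I2) := (Ideal.Quotient.mk _).comp f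
      have hg : Function.Surjective g := Ideal.Quotient.mk_surjective.comp hf
      rw [← ringKrullDim_eq_of_ringEquiv (RingHom.quotientKerEquivOfSurjective hg)]
      apply dim_quot_mono
      intro a ha
      have h1 : f a ∈ I1 ⊔ I2 := Ideal.Quotient.eq_zero_iff_mem.mp ha
      obtain ⟨u, hu, v, hv, huv⟩ := Submodule.mem_sup.mp h1
      obtain ⟨u, rfl⟩ := hf u
      have : a = u + (a - u) := by ring
      rw [this]
      refine Submodule.add_mem_sup hu ?_
      change f (a - u) ∈ I2
      rw [map_sub, ← huv, add_sub_cancel_left]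
      exact hv
  · left
    refine zd_mono hbd ?_
    have hZu : Z = PrimeSpectrum.zeroLocus ((⊥ : Ideal A) : Set A) := by
      rw [Set.not_nonempty_iff_eq_empty, Set.compl_empty_iff] at hne
      rw [hne, PrimeSpectrum.zeroLocus_bot]
    rw [hZu, dim_zeroLocus, ringKrullDim_eq_of_ringEquiv (RingEquiv.quotientBot A),
      ringKrullDim_eq_of_ringEquiv (RingHom.quotientKerEquivOfSurjective hf)]
end TopSec
end Wrap10

section Wrap11
section MainSec

lemma dim_radical {R : Type} [CommRing R] (J : Ideal R) :
    ringKrullDim (R ⧸ J.radical) = ringKrullDim (R ⧸ J) := by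
  rw [← dim_zeroLocus, ← dim_zeroLocus, PrimeSpectrum.zeroLocus_radical]

lemma exists_le_of_sInf_le {R : Type*} [CommRing R] {s : Set (Ideal R)} (hs : s.Finite) {p : Ideal R}
    (hp : p.IsPrime) (h : sInf s ≤ p) : ∃ q ∈ s, q ≤ p := by
  induction s, hs using Set.Finite.induction_on with
  | empty =>
    rw [sInf_empty] at h
    exact absurd (top_le_iff.mp h) hp.ne_top
  | insert _ _ ih =>
    rw [sInf_insert] at h
    rcases hp.inf_le.mp h with h | h
    · exact ⟨_, Set.mem_insert _ _, h⟩
    · obtain ⟨q, hq, hqp⟩ := ih h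
      exact ⟨q, Set.mem_insert_of_mem _ hq, hqp⟩

lemma upper_univ {R : Type} [CommRing R] {N : ℕ} (hN : ringKrullDim R ≤ N) (J : Ideal R) :
    connDim (PrimeSpectrum (R ⧸ J)) ≤ zd (ringKrullDim (R ⧸ J)) := by
  have := conn_upper_univ hN (Ideal.Quotient.mk J) Ideal.Quotient.mk_surjective
  rwa [Ideal.mk_ker] at this

lemma upper_two {R : Type} [CommRing R] {N : ℕ} (hN : ringKrullDim R ≤ N) (J : Ideal R)
    {J1 J2 : Ideal R} (hcov : ∀ q : Ideal R, q.IsPrime → J ≤ q → J1 ≤ q ∨ J2 ≤ q)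
    {q1 q2 : Ideal R} (hq1 : q1.IsPrime) (hq2 : q2.IsPrime) (h1 : J ≤ q1)
    (h2 : J ≤ q2) (hJ1 : ¬ J1 ≤ q1) (hJ2 : ¬ J2 ≤ q2) :
    connDim (PrimeSpectrum (R ⧸ J)) ≤ zd (ringKrullDim (R ⧸ (J1 ⊔ J2))) := by
  refine conn_upper hN (Ideal.Quotient.mk J) Ideal.Quotient.mk_surjective ?_ hq1 hq2 ?_ ?_ hJ1 hJ2
  · rwa [Ideal.mk_ker]
  · rwa [Ideal.mk_ker]
  · rwa [Ideal.mk_ker]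

lemma upper_min {R : Type} [CommRing R] [IsNoetherianRing R] {N : ℕ} (hN : ringKrullDim R ≤ N)
    (J : Ideal R) {s t : Set (Ideal R)} (hst : s ∪ t = J.minimalPrimes) (hd : Disjoint s t)
    (hs : s.Nonempty) (ht : t.Nonempty) :
    connDim (PrimeSpectrum (R ⧸ J)) ≤ zd (ringKrullDim (R ⧸ (sInf s ⊔ sInf t))) := by
  have hsm : s ⊆ J.minimalPrimes := hst ▸ Set.subset_union_left
  have htm : t ⊆ J.minimalPrimes := hst ▸ Set.subset_union_right
  have hfin := Ideal.finite_minimalPrimes_of_isNoetherianRing R J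
  obtain ⟨p, hp⟩ := hs
  obtain ⟨p', hp'⟩ := ht
  have key : ∀ q ∈ J.minimalPrimes, ∀ q' ∈ J.minimalPrimes, q ≤ q' → q = q' :=
    fun q hq q' hq' h => le_antisymm h (hq'.2 hq.1 h)
  refine upper_two hN J ?_ (htm hp').1.1 (hsm hp).1.1 (htm hp').1.2 (hsm hp).1.2 ?_ ?_
  · intro q hq hJq
    obtain ⟨q', hq', hqq⟩ := Ideal.exists_minimalPrimes_le hJq
    rw [← hst] at hq'
    rcases hq' with h | h
    · exact Or.inl ((sInf_le h).trans hqq)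
    · exact Or.inr ((sInf_le h).trans hqq)
  · intro h
    obtain ⟨q, hq, hqp⟩ := exists_le_of_sInf_le (hfin.subset hsm) (htm hp').1.1 h
    have := key q (hsm hq) p' (htm hp') hqp
    subst this
    exact Set.disjoint_left.mp hd hq hp'
  · intro h
    obtain ⟨q, hq, hqp⟩ := exists_le_of_sInf_le (hfin.subset htm) (hsm hp).1.1 h
    have := key q (htm hq) p (hsm hp) hqp
    subst this
    exact Set.disjoint_left.mp hd hp hq

lemma upper_drop {R : Type} [CommRing R] [IsNoetherianRing R] {N : ℕ} (hN : ringKrullDim R ≤ N)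
    (J : Ideal R) {p p' : Ideal R} (hp : p ∈ J.minimalPrimes) (hp' : p' ∈ J.minimalPrimes) (hne : p' ≠ p) :
    connDim (PrimeSpectrum (R ⧸ J)) + 1 ≤ zd (ringKrullDim (R ⧸ p)) := by
  have hfin := Ideal.finite_minimalPrimes_of_isNoetherianRing R J
  have h1 := upper_min hN J (s := {p}) (t := J.minimalPrimes \ {p})
    (Set.union_diff_cancel (Set.singleton_subset_iff.mpr hp)) Set.disjoint_sdiff_right
    ⟨p, rfl⟩ ⟨p', hp', hne⟩
  rw [sInf_singleton] at h1
  have hpp : p.IsPrime := hp.1.1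
  have h2 := dim_drop (J := p) (J' := p ⊔ sInf (J.minimalPrimes \ {p})) le_sup_left (by
    intro q hq hle
    have hqp : q ≤ p := hq.2 ⟨hpp, le_rfl⟩ hq.1.2
    obtain ⟨r, hr, hrp⟩ := exists_le_of_sInf_le (hfin.subset Set.diff_subset) hpp
      ((le_sup_right.trans hle).trans hqp)
    exact hr.2 (le_antisymm hrp (hp.2 hr.1.1 hrp)))
  have : Nontrivial (R ⧸ p) := Ideal.Quotient.nontrivial_iff.mpr hpp.ne_top
  have h3 := zd_succ_le (dim_bdd hN p) ringKrullDim_nonneg_of_nontrivial h2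
  linarith

lemma lower_two {R : Type} [CommRing R] {N : ℕ} (hN : ringKrullDim R ≤ N) (J : Ideal R) :
    zd (ringKrullDim (R ⧸ J)) ≤ connDim (PrimeSpectrum (R ⧸ J)) ∨
    ∃ J1 J2 q1 q2 : Ideal R, (∀ q : Ideal R, q.IsPrime → J ≤ q → J1 ≤ q ∨ J2 ≤ q) ∧
      q1.IsPrime ∧ q2.IsPrime ∧ J ≤ q1 ∧ J ≤ q2 ∧ ¬ J1 ≤ q1 ∧ ¬ J2 ≤ q2 ∧
      zd (ringKrullDim (R ⧸ (J1 ⊔ J2))) ≤ connDim (PrimeSpectrum (R ⧸ J)) := by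
  have := conn_lower hN (Ideal.Quotient.mk J) Ideal.Quotient.mk_surjective
  rwa [Ideal.mk_ker] at this

lemma lower_min {R : Type} [CommRing R] [IsNoetherianRing R] {N : ℕ} (hN : ringKrullDim R ≤ N) (J : Ideal R) :
    zd (ringKrullDim (R ⧸ J)) ≤ connDim (PrimeSpectrum (R ⧸ J)) ∨
    ∃ b c : Ideal R, (∃ s ⊆ J.minimalPrimes, b = sInf s) ∧ (∃ s ⊆ J.minimalPrimes, c = sInf s) ∧
      b * c ≤ J.radical ∧ ¬ b ≤ J.radical ∧ ¬ c ≤ J.radical ∧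
      zd (ringKrullDim (R ⧸ (b ⊔ c))) ≤ connDim (PrimeSpectrum (R ⧸ J)) := by
  rcases lower_two hN J with h | ⟨J1, J2, q1, q2, hcov, hq1, hq2, h1, h2, hJ1, hJ2, hd⟩
  · exact Or.inl h
  right
  have hfin := Ideal.finite_minimalPrimes_of_isNoetherianRing R J
  let s := {q | q ∈ J.minimalPrimes ∧ J1 ≤ q}
  let t := {q | q ∈ J.minimalPrimes ∧ ¬ J1 ≤ q}
  have hs : s ⊆ J.minimalPrimes := fun q h => h.1
  have ht : t ⊆ J.minimalPrimes := fun q h => h.1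
  have hs1 : J1 ≤ sInf s := le_sInf fun q hq => hq.2
  have ht2 : J2 ≤ sInf t := le_sInf fun q hq => (hcov q hq.1.1.1 hq.1.1.2).resolve_left hq.2
  refine ⟨sInf s, sInf t, ⟨s, hs, rfl⟩, ⟨t, ht, rfl⟩, ?_, ?_, ?_, ?_⟩
  · rw [Ideal.radical_eq_sInf]
    refine le_sInf fun q hq => ?_
    obtain ⟨q', hq', hqq⟩ := @Ideal.exists_minimalPrimes_le _ _ _ q hq.2 hq.1
    by_cases h : J1 ≤ q'
    · exact (Ideal.mul_le_left.trans (sInf_le (⟨hq', h⟩ : q' ∈ s))).trans hqq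
    · exact (Ideal.mul_le_right.trans (sInf_le (⟨hq', h⟩ : q' ∈ t))).trans hqq
  · intro h
    have h3 : J.radical ≤ q1 := hq1.radical_le_iff.mpr h1
    exact hJ1 (hs1.trans (h.trans h3))
  · intro h
    have h3 : J.radical ≤ q2 := hq2.radical_le_iff.mpr h2
    exact hJ2 (ht2.trans (h.trans h3))
  · exact (zd_mono (dim_bdd hN _) (dim_quot_mono (sup_le_sup hs1 ht2))).trans hd

open MvPolynomial
variable {k : Type} [Field k] {n : ℕ} {w : Fin n → ℕ}

lemma main_aux (I : Ideal (MvPolynomial (Fin n) k)) (hw : ∀ i, 0 < w i) :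
    connDim (PrimeSpectrum (MvPolynomial (Fin n) k ⧸ I)) ≤
      connDim (PrimeSpectrum (MvPolynomial (Fin n) k ⧸ initialIdeal w I)) ∨
    ∃ p ∈ I.minimalPrimes, zd (ringKrullDim (MvPolynomial (Fin n) k ⧸ p)) ≤
      connDim (PrimeSpectrum (MvPolynomial (Fin n) k ⧸ initialIdeal w I)) + 1 := by
  have hN : ringKrullDim (MvPolynomial (Fin n) k) ≤ n := (dim_mv n).le
  rcases lower_min hN (initialIdeal w I) with h | ⟨b, c, ⟨s, hs, hbs⟩, ⟨t, ht, hct⟩, hbc, hb, hc, hd⟩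
  · left
    exact ((upper_univ hN I).trans (zd_mono (dim_bdd hN _) (dim_initial_ge hw I))).trans h
  have hHb : HI w b := hbs ▸ HI.sInf fun q hq => (HI_initialIdeal I).minimalPrimes (hs hq)
  have hHc : HI w c := hct ▸ HI.sInf fun q hq => (HI_initialIdeal I).minimalPrimes (ht hq)
  have hfin := Ideal.finite_minimalPrimes_of_isNoetherianRing (MvPolynomial (Fin n) k) I
  by_cases hcase : ∃ p ∈ I.minimalPrimes, ¬ b ≤ (initialIdeal w p).radical ∧ ¬ c ≤ (initialIdeal w p).radical
  · right
    obtain ⟨p, hp, hbp, hcp⟩ := hcase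
    refine ⟨p, hp, ?_⟩
    have h1 := thmC hw hp.1.1 hHb hHc
      (hbc.trans (Ideal.radical_mono (initialIdeal_mono hp.1.2))) hbp hcp
    have h2 := zd_le_succ (dim_bdd hN _) (dim_bdd hN _) h1
    linarith
  · left
    push Not at hcase
    let S := {p | p ∈ I.minimalPrimes ∧ b ≤ (initialIdeal w p).radical}
    let T := {p | p ∈ I.minimalPrimes ∧ ¬ b ≤ (initialIdeal w p).radical}
    have hST : S ∪ T = I.minimalPrimes := by
      ext p
      constructor
      · rintro (h | h) <;> exact h.1
      · intro h
        by_cases h' : b ≤ (initialIdeal w p).radical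
        · exact Or.inl ⟨h, h'⟩
        · exact Or.inr ⟨h, h'⟩
    have hdis : Disjoint S T := Set.disjoint_left.mpr fun p h1 h2 => h2.2 h1.2
    have hSf : S.Finite := hfin.subset fun p h => h.1
    have hTf : T.Finite := hfin.subset fun p h => h.1
    have hbS : b ≤ (initialIdeal w (sInf S)).radical := le_radical_initialIdeal_sInf hSf fun p hp => hp.2
    have hcT : c ≤ (initialIdeal w (sInf T)).radical :=
      le_radical_initialIdeal_sInf hTf fun p hp => hcase p hp.1 hp.2
    have hall : ∀ U : Set (Ideal (MvPolynomial (Fin n) k)), U = I.minimalPrimes →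
        (initialIdeal w (sInf U)).radical ≤ (initialIdeal w I).radical := by
      rintro U rfl
      rw [Ideal.sInf_minimalPrimes]
      exact (Ideal.radical_mono (initialIdeal_radical I)).trans (Ideal.radical_idem _).le
    have hTne : T.Nonempty := by
      by_contra h
      rw [Set.not_nonempty_iff_eq_empty] at h
      rw [h, Set.union_empty] at hST
      exact hb (hbS.trans (hall S hST))
    have hSne : S.Nonempty := by
      by_contra h
      rw [Set.not_nonempty_iff_eq_empty] at h
      rw [h, Set.empty_union] at hST
      exact hc (hcT.trans (hall T hST))
    have h1 := upper_min hN I hST hdis hSne hTne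
    refine h1.trans (le_trans ?_ hd)
    refine zd_mono (dim_bdd hN _) ((dim_initial_ge hw _).trans ?_)
    rw [← dim_radical]
    refine dim_quot_mono (sup_le ?_ ?_)
    · exact hbS.trans (Ideal.radical_mono (initialIdeal_mono le_sup_left))
    · exact hcT.trans (Ideal.radical_mono (initialIdeal_mono le_sup_right))

end MainSec
end Wrap11

/-- Let `k` be a field, `P = k[x₁, …, xₙ]`, `I ⊆ P` an ideal and
`ω ∈ (ℤ_{>0})ⁿ` a weight vector.  Then `c(P/in_ω(I)) ≥ c(P/I) − 1`; moreover, if `I` has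
more than one minimal prime ideal, the inequality is strict, i.e.
`c(P/in_ω(I)) ≥ c(P/I)`. -/
theorem stmt_0 {k : Type} [Field k] {n : ℕ} (I : Ideal (MvPolynomial (Fin n) k))
    (ω : Fin n → ℕ) (hω : ∀ i, 0 < ω i) :
    connDim (PrimeSpectrum (MvPolynomial (Fin n) k ⧸ initialIdeal ω I)) ≥
        connDim (PrimeSpectrum (MvPolynomial (Fin n) k ⧸ I)) - 1 ∧
      ((∃ p ∈ I.minimalPrimes, ∃ q ∈ I.minimalPrimes, p ≠ q) →
        connDim (PrimeSpectrum (MvPolynomial (Fin n) k ⧸ initialIdeal ω I)) ≥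
          connDim (PrimeSpectrum (MvPolynomial (Fin n) k ⧸ I))) := by
  have hN : ringKrullDim (MvPolynomial (Fin n) k) ≤ n := (dim_mv n).le
  rcases main_aux I hω with h | ⟨p, hp, h⟩
  · exact ⟨by linarith, fun _ => h⟩
  by_cases hex : ∃ p' ∈ I.minimalPrimes, p' ≠ p
  · obtain ⟨p', hp', hne⟩ := hex
    have := upper_drop hN I hp hp' hne
    exact ⟨by linarith, fun _ => by linarith⟩
  · push Not at hex
    constructor
    · have h1 := upper_univ hN I
      have h2 : I.minimalPrimes = {p} :=
        Set.eq_singleton_iff_unique_mem.mpr ⟨hp, hex⟩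
      have h3 : I.radical = p := by
        rw [← Ideal.sInf_minimalPrimes, h2, sInf_singleton]
      rw [← dim_radical, h3] at h1
      linarith
    · rintro ⟨a, ha, b, hb, hab⟩
      exact absurd ((hex a ha).trans (hex b hb).symm) hab
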